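/- Let 𝕂 be a valued field whose value group has a least positive element, regarded as an L_VR-structure, elementarily equivalent to ℂ((t)), with residue field k_𝕂, and let K be an elementary L_VR-substructure of 𝕂 with residue field k ⊆ k_𝕂. Then for every algebraically closed subfield E of k_𝕂 with k ⊆ E, there exists an elementary L_VR-substructure K₁ of 𝕂 with K ⊆ K₁ whose residue field, as a subfield of k_𝕂, equals E. -/

import Mathlib

open FirstOrder

/-- The function symbols of the language `L_VR`: the ring language `{0, 1, +, ×}`. -/
inductive LVRFunc : ℕ → Type
  | zero : LVRFunc 0
  | one : LVRFunc 0
  | add : LVRFunc 2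
  | mul : LVRFunc 2

/-- The relation symbols of the language `L_VR`: a binary divisibility relation `|`,
a unary relation `N`, and a unary relation `P_n` for each `n ≥ 1`. -/
inductive LVRRel : ℕ → Type
  | dvd : LVRRel 2
  | N : LVRRel 1
  | pow : ℕ+ → LVRRel 1

/-- The first-order language `L_VR` of valuation rings. -/
def LVR : FirstOrder.Language where
  Functions := LVRFunc
  Relations := LVRRel

/-- Interpretation of the `L_VR` function symbols in a field. -/
def LVRfun (K : Type*) [Field K] : ∀ {n : ℕ}, LVRFunc n → (Fin n → K) → K
  | _, .zero => fun _ => 0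
  | _, .one => fun _ => 1
  | _, .add => fun x => x 0 + x 1
  | _, .mul => fun x => x 0 * x 1

/-- Interpretation of the `L_VR` relation symbols in a valued field (Mathlib's
multiplicative convention for valuations is order-reversing w.r.t. the additive
convention of the paper: `x | y` means `v_add(x) ≤ v_add(y)`, i.e. multiplicatively
`v (x 1) ≤ v (x 0)`; `N x` means `v_add(x) = 1_Γ`, where `γ₁` is the multiplicative
avatar of the least positive element of the value group; `P_n x` means `x` is an
`n`-th power). -/
def LVRrel {K : Type*} [Field K] {Γ₀ : Type*} [LinearOrderedCommGroupWithZero Γ₀]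
    (v : Valuation K Γ₀) (γ₁ : Γ₀) : ∀ {n : ℕ}, LVRRel n → (Fin n → K) → Prop
  | _, .dvd => fun x => v (x 1) ≤ v (x 0)
  | _, .N => fun x => v (x 0) = γ₁
  | _, .pow m => fun x => ∃ y : K, x 0 = y ^ (m : ℕ)

/-- A valued field, together with the (multiplicative avatar of the) least positive
element of its value group, as an `L_VR`-structure. -/
def valuedStructure {K : Type*} [Field K] {Γ₀ : Type*} [LinearOrderedCommGroupWithZero Γ₀]
    (v : Valuation K Γ₀) (γ₁ : Γ₀) : LVR.Structure K where
  funMap := LVRfun K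
  RelMap := LVRrel v γ₁

/-- `γ₁` is the multiplicative avatar of the least positive element of the value
group: the greatest element of `Γ₀ ∖ {0}` that is `< 1`. -/
def IsLeastPos {Γ₀ : Type*} [LinearOrderedCommGroupWithZero Γ₀] (γ₁ : Γ₀) : Prop :=
  γ₁ ≠ 0 ∧ γ₁ < 1 ∧ ∀ δ : Γ₀, δ ≠ 0 → δ < 1 → δ ≤ γ₁

/-- `ℂ((t))`, the field of formal Laurent series over `ℂ` with its `t`-adic
valuation, as an `L_VR`-structure. -/
noncomputable def laurentStructure : LVR.Structure (LaurentSeries ℂ) :=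
  valuedStructure (Valued.v : Valuation (LaurentSeries ℂ) (WithZero (Multiplicative ℤ)))
    ((Multiplicative.ofAdd (-1 : ℤ) : Multiplicative ℤ) : WithZero (Multiplicative ℤ))


open Polynomial

section Valuation

variable {K Γ : Type*} [Field K] [LinearOrderedCommGroupWithZero Γ]

/-- If `p` and `q` have the same leading terms as `t` and `t'`, then `p / q` has the same leading
term as `t / t'`. -/
theorem Valuation.map_div_sub_div_lt_one (v : Valuation K Γ) {p q t t' : K}
    (hp : v (p - t) < v p) (hq : v (q - t') < v q) (h : v p = v q) :
    v (p / q - t / t') < 1 := by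
  have hq0 : v q ≠ 0 := (lt_of_le_of_lt zero_le hq).ne'
  have ht : v t = v p := by
    have := v.map_sub_eq_of_lt_left hp
    rwa [sub_sub_cancel] at this
  have ht' : v t' = v q := by
    have := v.map_sub_eq_of_lt_left hq
    rwa [sub_sub_cancel] at this
  have hq1 : q ≠ 0 := (v.ne_zero_iff).1 hq0
  have ht1 : t' ≠ 0 := (v.ne_zero_iff).1 (ht'.trans_ne hq0)
  have e : p / q - t / t' = ((p - t) * t' - t * (q - t')) / (q * t') := by
    field_simp
    ring
  have hpos : 0 < v q := zero_lt_iff.2 hq0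
  rw [e, map_div₀, map_mul, ht', div_lt_one₀ (mul_pos hpos hpos)]
  refine v.map_sub_lt ?_ ?_
  · rw [map_mul, ht', ← h]
    exact mul_lt_mul_of_pos_right hp (h ▸ hpos)
  · rw [map_mul, ht, h]
    exact mul_lt_mul_of_pos_left hq hpos

theorem Valuation.map_eval_le_one (v : Valuation K Γ) {p : K[X]} (hp : ∀ k, v (p.coeff k) ≤ 1)
    {x : K} (hx : v x ≤ 1) : v (p.eval x) ≤ 1 := by
  rw [eval_eq_sum_range]
  refine v.map_sum_le fun k _ ↦ ?_
  rw [map_mul, map_pow]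
  exact mul_le_one' (hp k) (pow_le_one' hx k)

theorem Valuation.map_natCast_le_one (v : Valuation K Γ) (n : ℕ) : v (n : K) ≤ 1 :=
  natCast_mem v.integer n

theorem Valuation.map_hasseDeriv_coeff_le_one (v : Valuation K Γ) {p : K[X]}
    (hp : ∀ k, v (p.coeff k) ≤ 1) (n k : ℕ) : v ((hasseDeriv n p).coeff k) ≤ 1 := by
  rw [hasseDeriv_coeff, map_mul]
  exact mul_le_one' (v.map_natCast_le_one _) (hp _)

/-- A form of Hensel's lemma: a polynomial whose reduction is a separable polynomial of
degree one has a root. -/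
def Valuation.IsHensel (v : Valuation K Γ) : Prop :=
  ∀ p : K[X], v (p.coeff 0) ≤ 1 → v (p.coeff 1) = 1 → (∀ k, 2 ≤ k → v (p.coeff k) < 1) →
    ∃ y, v y ≤ 1 ∧ p.eval y = 0

/-- Monic nonconstant polynomials over `B` have a root in `B` up to elements of positive
value. -/
def Valuation.HasResidueRoots (v : Valuation K Γ) (B : Subring K) : Prop :=
  ∀ p : K[X], p.Monic → 0 < p.natDegree → (∀ k, p.coeff k ∈ B) → ∃ x ∈ B, v (p.eval x) < 1

/-- A surjective valuation satisfying Hensel's lemma, with algebraically closed residue field of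
characteristic zero. -/
structure Valuation.IsTame (v : Valuation K Γ) : Prop where
  surj : Function.Surjective v
  natCast : ∀ n : ℕ, n ≠ 0 → v (n : K) = 1
  hensel : v.IsHensel
  roots : v.HasResidueRoots v.integer

/-- `B` is the preimage in the valuation ring of an algebraically closed subfield of the residue
field. -/
structure Valuation.IsResiduePreimage (v : Valuation K Γ) (B : Subring K) : Prop where
  le_one : ∀ x ∈ B, v x ≤ 1
  mem_of_lt_one : ∀ x, v x < 1 → x ∈ B
  inv_mem : ∀ x ∈ B, v x = 1 → x⁻¹ ∈ B
  roots : v.HasResidueRoots B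

theorem Valuation.IsTame.isResiduePreimage {v : Valuation K Γ} (hv : v.IsTame) :
    v.IsResiduePreimage v.integer where
  le_one _ h := h
  mem_of_lt_one _ h := h.le
  inv_mem x _ h := by
    change v x⁻¹ ≤ 1
    rw [map_inv₀, h, inv_one]
  roots := hv.roots

theorem Valuation.IsHensel.exists_root {v : Valuation K Γ} (hv : v.IsHensel) (p : K[X])
    {s : K} (hs : s ≠ 0) (h1 : p.coeff 1 ≠ 0) (h0 : v (p.coeff 0) ≤ v (p.coeff 1) * v s)
    (h2 : ∀ k, 2 ≤ k → v (p.coeff k) * v s ^ k < v (p.coeff 1) * v s) :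
    ∃ y, v y ≤ v s ∧ p.eval y = 0 := by
  set d := p.coeff 1 * s with hd
  have hd0 : d ≠ 0 := mul_ne_zero h1 hs
  have hpos : 0 < v d := zero_lt_iff.2 ((v.ne_zero_iff).2 hd0)
  have hc : ∀ k, v ((C d⁻¹ * p.comp (C s * X)).coeff k) = v (p.coeff k) * v s ^ k / v d := by
    intro k
    rw [coeff_C_mul, comp_C_mul_X_coeff, map_mul, map_mul, map_inv₀, map_pow, div_eq_mul_inv,
      mul_comm]
  obtain ⟨y, hy, hy0⟩ := hv (C d⁻¹ * p.comp (C s * X))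
    (by rw [hc, pow_zero, mul_one, div_le_one₀ hpos, hd, map_mul]; exact h0)
    (by rw [hc, pow_one, hd, map_mul, div_self]; rw [← map_mul]; exact hpos.ne')
    (fun k hk ↦ by rw [hc, div_lt_one₀ hpos, hd, map_mul]; exact h2 k hk)
  refine ⟨s * y, ?_, ?_⟩
  · rw [map_mul]
    exact mul_le_of_le_one_right' hy
  · simpa [eval_comp, hd0] using hy0

theorem Valuation.IsHensel.exists_root_near {v : Valuation K Γ} (hv : v.IsHensel) {p : K[X]}
    (hp : ∀ k, v (p.coeff k) ≤ 1) {x : K} (hx : v x ≤ 1) (h0 : v (p.eval x) < 1)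
    (h1 : v (p.derivative.eval x) = 1) : ∃ y, v (y - x) < 1 ∧ p.eval y = 0 := by
  by_cases hz : p.eval x = 0
  · exact ⟨x, by simp, hz⟩
  have c0 : (taylor x p).coeff 0 = p.eval x := taylor_coeff_zero x p
  have c1 : (taylor x p).coeff 1 = p.derivative.eval x := taylor_coeff_one x p
  obtain ⟨y, hy, hy0⟩ := hv.exists_root (taylor x p) hz
    (by rw [c1]; intro h; simp [h] at h1)
    (by rw [c0, c1, h1, one_mul])
    (fun k hk ↦ by
      rw [c1, h1, one_mul, taylor_coeff]
      calc _ ≤ v (p.eval x) ^ k :=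
            mul_le_of_le_one_left' (v.map_eval_le_one (v.map_hasseDeriv_coeff_le_one hp k) hx)
        _ < v (p.eval x) ^ 1 :=
            pow_lt_pow_right_of_lt_one₀ (zero_lt_iff.2 ((v.ne_zero_iff).2 hz)) h0 (by omega)
        _ = _ := pow_one _)
  refine ⟨y + x, by simpa using hy.trans_lt h0, ?_⟩
  rw [taylor_eval] at hy0
  exact hy0

theorem Valuation.IsTame.exists_pow_eq {v : Valuation K Γ} (hv : v.IsTame) {m : ℕ} (hm : m ≠ 0)
    {c : K} {γ : Γ} (hγ : γ ≠ 0) (h : v c = γ ^ m) : ∃ b, v b = γ ∧ b ^ m = c := by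
  obtain ⟨x, rfl⟩ := hv.surj γ
  have hx : x ≠ 0 := (v.ne_zero_iff).1 hγ
  set u := c / x ^ m with hu
  have hvu : v u = 1 := by
    rw [hu, map_div₀, map_pow, h, div_self (pow_ne_zero _ hγ)]
  have hcoeff : ∀ k, v ((X ^ m - C u : K[X]).coeff k) ≤ 1 := by
    intro k
    rw [coeff_sub, coeff_X_pow, coeff_C]
    refine v.map_sub_le ?_ ?_ <;> split_ifs <;> simp [hvu]
  obtain ⟨y, hy, hy1⟩ := hv.roots (X ^ m - C u) (monic_X_pow_sub_C u hm)
    (by rw [natDegree_X_pow_sub_C]; omega) hcoeff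
  have hy2 : v y = 1 := by
    have h1 : v (y ^ m) = v u := by
      have : y ^ m = u + (X ^ m - C u : K[X]).eval y := by simp
      rw [this]
      exact v.map_add_eq_of_lt_left (by rwa [hvu])
    rw [map_pow, hvu] at h1
    exact (pow_eq_one_iff_of_nonneg zero_le hm).1 h1
  obtain ⟨z, hz, hz0⟩ := hv.hensel.exists_root_near hcoeff hy hy1 (by
    simp [derivative_X_pow, hv.natCast m hm, hy2])
  have hz1 : z ^ m = u := by simpa [sub_eq_zero] using hz0
  refine ⟨x * z, ?_, ?_⟩
  · have : v z = 1 := by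
      have h1 : v (z ^ m) = 1 := by rw [hz1, hvu]
      rw [map_pow] at h1
      exact (pow_eq_one_iff_of_nonneg zero_le hm).1 h1
    rw [map_mul, this, mul_one]
  · rw [mul_pow, hz1, hu, mul_div_cancel₀ _ (pow_ne_zero _ hx)]

end Valuation

section Monomial

variable {F L Γ : Type*} [Field F] [Field L] [LinearOrderedCommGroupWithZero Γ]
  {w : Valuation F Γ} {v : Valuation L Γ} {i : F →+* L}

/-- If no small power of `γ` is the value of an element of `F`, a polynomial of small degree has
a monomial that is dominant at elements of value `γ`. -/
theorem exists_monomial_dominant {γ : Γ} (hγ : γ ≠ 0) {Q : F[X]}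
    (hQ : Q ≠ 0) (h : ∀ k, 0 < k → k ≤ Q.natDegree → ∀ c, w c ≠ γ ^ k) :
    ∃ k ≤ Q.natDegree, Q.coeff k ≠ 0 ∧
      ∀ l ≤ Q.natDegree, l ≠ k → w (Q.coeff l) * γ ^ l < w (Q.coeff k) * γ ^ k := by
  obtain ⟨k, hk, hmax⟩ := Finset.exists_max_image (Finset.range (Q.natDegree + 1))
    (fun k ↦ w (Q.coeff k) * γ ^ k) ⟨0, by simp⟩
  have hpos : 0 < w (Q.coeff k) * γ ^ k := by
    refine lt_of_lt_of_le (zero_lt_iff.2 (mul_ne_zero ?_ (pow_ne_zero Q.natDegree hγ)))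
      (hmax Q.natDegree (by simp))
    rw [w.ne_zero_iff, coeff_natDegree]
    exact leadingCoeff_ne_zero.2 hQ
  have hk0 : Q.coeff k ≠ 0 := (w.ne_zero_iff).1 (left_ne_zero_of_mul hpos.ne')
  have hne : ∀ a b : ℕ, a < b → b ≤ Q.natDegree → Q.coeff b ≠ 0 →
      w (Q.coeff a) * γ ^ a ≠ w (Q.coeff b) * γ ^ b := by
    intro a b hab hb hb0 e
    refine h (b - a) (by omega) (by omega) (Q.coeff a / Q.coeff b) ?_
    rw [map_div₀, div_eq_iff ((w.ne_zero_iff).2 hb0)]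
    have : γ ^ b = γ ^ (b - a) * γ ^ a := by rw [← pow_add]; congr 1; omega
    rw [this, ← mul_assoc] at e
    rw [mul_right_cancel₀ (pow_ne_zero a hγ) e, mul_comm]
  have hk2 := Finset.mem_range.1 hk
  refine ⟨k, by omega, hk0, fun l hl hlk ↦ ?_⟩
  refine lt_of_le_of_ne (hmax l (Finset.mem_range.2 (by omega))) ?_
  rcases lt_or_gt_of_ne hlk with hlk | hlk
  · exact hne l k hlk (by omega) hk0
  · by_cases hl0 : Q.coeff l = 0
    · rw [hl0, map_zero, zero_mul]
      exact hpos.ne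
    · exact (hne k l hlk (by omega) hl0).symm

theorem map_eval₂_of_monomial_dominant (hi : ∀ x, v (i x) = w x) {γ : Γ} (hγ : γ ≠ 0) {Q : F[X]}
    {k : ℕ} (hk : k ≤ Q.natDegree) (hk0 : Q.coeff k ≠ 0)
    (h : ∀ l ≤ Q.natDegree, l ≠ k → w (Q.coeff l) * γ ^ l < w (Q.coeff k) * γ ^ k)
    {b : L} (hb : v b = γ) :
    v (Q.eval₂ i b - i (Q.coeff k) * b ^ k) < v (Q.eval₂ i b) ∧
      v (Q.eval₂ i b) = w (Q.coeff k) * γ ^ k := by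
  have hd : v (Q.eval₂ i b - i (Q.coeff k) * b ^ k) < w (Q.coeff k) * γ ^ k := by
    rw [eval₂_eq_sum_range, ← Finset.add_sum_erase _ _ (Finset.mem_range.2 (Nat.lt_succ_of_le hk)),
      add_sub_cancel_left]
    refine v.map_sum_lt (mul_ne_zero ((w.ne_zero_iff).2 hk0) (pow_ne_zero k hγ)) fun l hl ↦ ?_
    rw [Finset.mem_erase, Finset.mem_range] at hl
    rw [map_mul, map_pow, hi, hb]
    exact h l (by omega) hl.1
  have he : v (Q.eval₂ i b) = w (Q.coeff k) * γ ^ k := by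
    have hm : v (i (Q.coeff k) * b ^ k) = w (Q.coeff k) * γ ^ k := by
      rw [map_mul, map_pow, hi, hb]
    have := v.map_add_eq_of_lt_left (hd.trans_eq hm.symm)
    rwa [add_sub_cancel, hm] at this
  exact ⟨he ▸ hd, he⟩

end Monomial

section Factor

variable {F L Γ : Type*} [Field F] [Field L] [LinearOrderedCommGroupWithZero Γ]
  {w : Valuation F Γ} {v : Valuation L Γ} {i : F →+* L}

theorem Valuation.map_prod_X_sub_C_coeff_le_one (w : Valuation F Γ) {s : Multiset F}
    (hs : ∀ c ∈ s, w c ≤ 1) (k : ℕ) : w ((s.map fun c ↦ X - C c).prod.coeff k) ≤ 1 := by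
  induction s using Multiset.induction_on generalizing k with
  | empty =>
    rw [Multiset.map_zero, Multiset.prod_zero, coeff_one]
    split_ifs <;> simp
  | cons a s ih =>
    rw [Multiset.map_cons, Multiset.prod_cons, sub_mul, coeff_sub, coeff_C_mul]
    have ih' := ih fun c hc ↦ hs c (Multiset.mem_cons_of_mem hc)
    refine w.map_sub_le ?_ ?_
    · cases k with
      | zero => simp
      | succ k => rw [coeff_X_mul]; exact ih' k
    · rw [map_mul]
      exact mul_le_one' (hs a (Multiset.mem_cons_self a s)) (ih' k)

/-- If monic integral polynomials of degree less than `m` have roots up to elements of positive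
value, then the reduction of every polynomial of degree less than `m` splits. -/
theorem Valuation.exists_approx_factorization (w : Valuation F Γ) (m : ℕ)
    (h : ∀ p : F[X], p.Monic → 0 < p.natDegree → p.natDegree < m → (∀ k, w (p.coeff k) ≤ 1) →
      ∃ x, w x ≤ 1 ∧ w (p.eval x) < 1) (n : ℕ) :
    ∀ Q : F[X], Q ≠ 0 → Q.natDegree = n → n < m → ∃ d : F, d ≠ 0 ∧ ∃ s : Multiset F,
      (∀ c ∈ s, w c ≤ 1) ∧
        ∀ k, w ((Q - C d * (s.map fun c ↦ X - C c).prod).coeff k) < w d := by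
  induction n using Nat.strong_induction_on with
  | _ n ih =>
  intro Q hQ hn hm
  have hlc : Q.leadingCoeff ≠ 0 := leadingCoeff_ne_zero.2 hQ
  have hpos : 0 < w Q.leadingCoeff := zero_lt_iff.2 ((w.ne_zero_iff).2 hlc)
  by_cases hmax : ∀ k, w (Q.coeff k) ≤ w Q.leadingCoeff
  · rcases Nat.eq_zero_or_pos n with rfl | hn0
    · refine ⟨Q.leadingCoeff, hlc, 0, by simp, fun k ↦ ?_⟩
      have : Q - C Q.leadingCoeff * 1 = 0 := by
        rw [mul_one, sub_eq_zero, leadingCoeff, hn]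
        exact eq_C_of_natDegree_eq_zero hn
      rw [Multiset.map_zero, Multiset.prod_zero, this]
      simpa using hpos
    · set P := C Q.leadingCoeff⁻¹ * Q with hP
      have hPQ : Q = C Q.leadingCoeff * P := by
        rw [hP, ← mul_assoc, ← C_mul, mul_inv_cancel₀ hlc, C_1, one_mul]
      have hPm : P.Monic := by
        rw [hP, mul_comm]
        exact monic_mul_leadingCoeff_inv hQ
      have hPd : P.natDegree = n := by
        rw [hP, natDegree_C_mul (inv_ne_zero hlc), hn]
      obtain ⟨a, ha, hPa⟩ := h P hPm (by omega) (by omega) fun k ↦ by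
        rw [hP, coeff_C_mul, map_mul, map_inv₀, inv_mul_le_one₀ hpos]
        exact hmax k
      have hdiv : P = (X - C a) * (P /ₘ (X - C a)) + C (P.eval a) := by
        rw [← modByMonic_X_sub_C_eq_C_eval, add_comm]
        exact (modByMonic_add_div P (X - C a)).symm
      have hR0 : P /ₘ (X - C a) ≠ 0 := by
        intro h0
        rw [h0, mul_zero, zero_add] at hdiv
        have := congrArg natDegree hdiv
        rw [natDegree_C] at this
        omega
      have hRd : (P /ₘ (X - C a)).natDegree = n - 1 := by
        rw [natDegree_divByMonic _ (monic_X_sub_C a), hPd, natDegree_X_sub_C]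
      have hRm : (P /ₘ (X - C a)).Monic := by
        refine (monic_X_sub_C a).of_mul_monic_left ?_
        have : (X - C a) * (P /ₘ (X - C a)) = P - C (P.eval a) := by
          conv_rhs => rw [hdiv]
          simp
        rw [this]
        refine hPm.sub_of_left ?_
        refine degree_C_le.trans_lt ?_
        rw [← natDegree_pos_iff_degree_pos]
        omega
      obtain ⟨d, hd, s, hs, hds⟩ := ih (n - 1) (by omega) _ hR0 hRd (by omega)
      set S := (s.map fun c ↦ X - C c).prod with hS
      have hwd : 1 ≤ w d := by
        by_contra hlt
        push Not at hlt
        have h1 := hds (n - 1)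
        rw [coeff_sub, ← hRd, coeff_natDegree, hRm.leadingCoeff, coeff_C_mul] at h1
        have h2 : w (d * S.coeff (P /ₘ (X - C a)).natDegree) < w (1 : F) := by
          rw [map_mul, map_one]
          exact (mul_le_of_le_one_right' (w.map_prod_X_sub_C_coeff_le_one hs _)).trans_lt hlt
        rw [w.map_sub_eq_of_lt_left h2, map_one] at h1
        exact absurd h1 hlt.le.not_gt
      refine ⟨Q.leadingCoeff * d, mul_ne_zero hlc hd, a ::ₘ s, ?_, fun k ↦ ?_⟩
      · intro c hc
        rcases Multiset.mem_cons.1 hc with rfl | hc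
        · exact ha
        · exact hs c hc
      · have e : Q - C (Q.leadingCoeff * d) * ((a ::ₘ s).map fun c ↦ X - C c).prod =
            C Q.leadingCoeff * ((X - C a) * (P /ₘ (X - C a) - C d * S) + C (P.eval a)) := by
          rw [Multiset.map_cons, Multiset.prod_cons, ← hS, C_mul]
          conv_lhs => rw [hPQ]
          rw [leadingCoeff_mul, leadingCoeff_C, hPm.leadingCoeff, mul_one]
          conv_lhs => rw [hdiv]
          ring
        rw [e, coeff_C_mul, map_mul, map_mul]
        refine mul_lt_mul_of_pos_left ?_ hpos
        rw [coeff_add, sub_mul, coeff_sub, coeff_C_mul]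
        refine w.map_add_lt (w.map_sub_lt ?_ ?_) ?_
        · cases k with
          | zero => simpa [zero_lt_iff] using hd
          | succ k => rw [coeff_X_mul]; exact hds k
        · rw [map_mul]
          exact (mul_le_of_le_one_left' ha).trans_lt (hds k)
        · rw [coeff_C]
          split_ifs
          · exact hPa.trans_le hwd
          · simpa [zero_lt_iff] using hd
  · push Not at hmax
    obtain ⟨k₀, hk₀⟩ := hmax
    have hne : k₀ ≠ Q.natDegree := by
      rintro rfl
      exact hk₀.ne rfl
    have hk1 : Q.coeff k₀ ≠ 0 := by
      rw [← w.ne_zero_iff]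
      exact (hpos.trans hk₀).ne'
    have hE0 : Q.eraseLead.coeff k₀ = Q.coeff k₀ := eraseLead_coeff_of_ne _ hne
    have hEne : Q.eraseLead ≠ 0 := by
      intro h0
      rw [h0, coeff_zero] at hE0
      exact hk1 hE0.symm
    have hn0 : 0 < n := by
      have := le_natDegree_of_ne_zero hk1
      omega
    have hEd : Q.eraseLead.natDegree < n := by
      have := eraseLead_natDegree_le Q
      omega
    obtain ⟨d, hd, s, hs, hds⟩ := ih _ hEd _ hEne rfl (hEd.trans hm)
    refine ⟨d, hd, s, hs, fun k ↦ ?_⟩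
    set S := (s.map fun c ↦ X - C c).prod with hS
    have hwd : w (Q.coeff k₀) ≤ w d := by
      have e : Q.coeff k₀ = (Q.eraseLead - C d * S).coeff k₀ + d * S.coeff k₀ := by
        rw [coeff_sub, coeff_C_mul, hE0]
        ring
      rw [e]
      refine w.map_add_le (hds k₀).le ?_
      rw [map_mul]
      exact mul_le_of_le_one_right' (w.map_prod_X_sub_C_coeff_le_one hs _)
    have e : Q - C d * S = (Q.eraseLead - C d * S) + C Q.leadingCoeff * X ^ Q.natDegree := by
      conv_lhs => rw [← eraseLead_add_C_mul_X_pow Q]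
      ring
    rw [e, coeff_add]
    refine w.map_add_lt (hds k) ?_
    rw [coeff_C_mul, coeff_X_pow]
    split_ifs
    · rw [mul_one]
      exact hk₀.trans_le hwd
    · simpa [zero_lt_iff] using hd

theorem map_eval₂_le_of_coeff_lt (hi : ∀ x, v (i x) = w x) {Q : F[X]} {γ : Γ} (hγ : γ ≠ 0)
    (h : ∀ k, w (Q.coeff k) < γ) {u : L} (hu : v u ≤ 1) : v (Q.eval₂ i u) < γ := by
  rw [eval₂_eq_sum_range]
  refine v.map_sum_lt hγ fun k _ ↦ ?_
  rw [map_mul, map_pow, hi]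
  exact (mul_le_of_le_one_right' (pow_le_one' hu k)).trans_lt (h k)

/-- Evaluation of an approximately factored polynomial at an element whose residue is not one of
the roots of its reduction. -/
theorem map_eval₂_of_approx_factorization (hi : ∀ x, v (i x) = w x) {Q : F[X]} {d : F}
    (hd : d ≠ 0) {s : Multiset F}
    (h : ∀ k, w ((Q - C d * (s.map fun c ↦ X - C c).prod).coeff k) < w d) {u : L} (hu : v u ≤ 1)
    (hus : ∀ c ∈ s, v (u - i c) = 1) :
    v (Q.eval₂ i u) = w d ∧
      v (Q.eval₂ i u - i d * (s.map fun c ↦ u - i c).prod) < v (Q.eval₂ i u) ∧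
      v (s.map fun c ↦ u - i c).prod = 1 := by
  have hprod : v (s.map fun c ↦ u - i c).prod = 1 := by
    rw [map_multiset_prod, Multiset.map_map]
    refine Multiset.prod_eq_one fun x hx ↦ ?_
    obtain ⟨c, hc, rfl⟩ := Multiset.mem_map.1 hx
    exact hus c hc
  have h1 := map_eval₂_le_of_coeff_lt hi ((w.ne_zero_iff).2 hd) h hu
  have e : (C d * (s.map fun c ↦ X - C c).prod).eval₂ i u =
      i d * (s.map fun c ↦ u - i c).prod := by
    rw [eval₂_mul, eval₂_C, ← coe_eval₂RingHom, map_multiset_prod, Multiset.map_map]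
    simp [Function.comp_def]
  rw [eval₂_sub, e] at h1
  have h2 : v (i d * (s.map fun c ↦ u - i c).prod) = w d := by
    rw [map_mul, hprod, mul_one, hi]
  have h3 : v (Q.eval₂ i u) = w d := by
    have := v.map_add_eq_of_lt_left (h1.trans_eq h2.symm)
    rwa [add_sub_cancel, h2] at this
  exact ⟨h3, h3 ▸ h1, hprod⟩

end Factor

section Limit

open Filter

variable {F L Γ : Type*} [Field F] [Field L] [LinearOrderedCommGroupWithZero Γ]
  {w : Valuation F Γ} {v : Valuation L Γ} {i : F →+* L}

/-- `δ a` behaves like the value of `b - a` for an element `b` of an immediate extension. -/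
structure Valuation.IsLimit (w : Valuation F Γ) (δ : F → Γ) : Prop where
  no_min : ∀ a₀, ∃ a, δ a < δ a₀
  dist : ∀ a a', δ a' < δ a → w (a' - a) = δ a

/-- The filter of approximations. -/
def limitFilter (δ : F → Γ) : Filter F where
  sets := {s | ∃ a₀, ∀ a, δ a < δ a₀ → a ∈ s}
  univ_sets := ⟨0, fun _ _ ↦ trivial⟩
  sets_of_superset := fun ⟨a₀, h⟩ hst ↦ ⟨a₀, fun a ha ↦ hst (h a ha)⟩
  inter_sets := by
    rintro s t ⟨a, ha⟩ ⟨b, hb⟩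
    rcases le_total (δ a) (δ b) with h | h
    · exact ⟨a, fun c hc ↦ ⟨ha c hc, hb c (hc.trans_le h)⟩⟩
    · exact ⟨b, fun c hc ↦ ⟨ha c (hc.trans_le h), hb c hc⟩⟩

theorem eventually_limitFilter {δ : F → Γ} {p : F → Prop} :
    (∀ᶠ a in limitFilter δ, p a) ↔ ∃ a₀, ∀ a, δ a < δ a₀ → p a := Iff.rfl

theorem eventually_lt_limitFilter (δ : F → Γ) (a₀ : F) : ∀ᶠ a in limitFilter δ, δ a < δ a₀ :=
  eventually_limitFilter.2 ⟨a₀, fun _ h ↦ h⟩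

theorem Valuation.IsLimit.neBot {δ : F → Γ} (hδ : w.IsLimit δ) : (limitFilter δ).NeBot := by
  refine ⟨fun h ↦ ?_⟩
  have : ∀ᶠ a in limitFilter δ, False := by rw [h]; exact eventually_bot
  obtain ⟨a₀, ha₀⟩ := eventually_limitFilter.1 this
  obtain ⟨a, ha⟩ := hδ.no_min a₀
  exact ha₀ a ha

theorem Valuation.IsLimit.pos {δ : F → Γ} (hδ : w.IsLimit δ) (a : F) : 0 < δ a := by
  obtain ⟨a', ha'⟩ := hδ.no_min a
  exact lt_of_le_of_lt zero_le ha'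

/-- The value of `Q` is eventually constant. -/
def Valuation.IsStable (w : Valuation F Γ) (δ : F → Γ) (Q : F[X]) : Prop :=
  ∃ γ, ∀ᶠ a in limitFilter δ, w (Q.eval a) = γ

theorem Valuation.IsLimit.exists_stable_values {δ : F → Γ} {Q : F[X]} {m : ℕ}
    (h : ∀ k, m ≤ k → w.IsStable δ (hasseDeriv k Q)) :
    ∃ γ : ℕ → Γ, ∀ᶠ a in limitFilter δ, ∀ k, m ≤ k → w ((hasseDeriv k Q).eval a) = γ k := by
  have : ∀ k, ∃ γ, m ≤ k → ∀ᶠ a in limitFilter δ, w ((hasseDeriv k Q).eval a) = γ := by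
    intro k
    by_cases hk : m ≤ k
    · obtain ⟨γ, hγ⟩ := h k hk
      exact ⟨γ, fun _ ↦ hγ⟩
    · exact ⟨0, fun h ↦ absurd h hk⟩
  choose γ hγ using this
  refine ⟨fun k ↦ if k ≤ Q.natDegree then γ k else 0, ?_⟩
  have h1 : ∀ᶠ a in limitFilter δ, ∀ k ∈ Finset.Icc m Q.natDegree,
      w ((hasseDeriv k Q).eval a) = γ k :=
    (eventually_all_finset _).2 fun k hk ↦ hγ k (Finset.mem_Icc.1 hk).1
  filter_upwards [h1] with a ha k hk
  split_ifs with hkn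
  · exact ha k (Finset.mem_Icc.2 ⟨hk, hkn⟩)
  · rw [hasseDeriv_eq_zero_of_lt_natDegree _ _ (not_le.1 hkn), eval_zero, map_zero]

theorem eval₂_eq_sum_hasseDeriv (i : F →+* L) (Q : F[X]) (a : F) (x : L) :
    Q.eval₂ i x = i (Q.eval a) +
      ∑ k ∈ Finset.Icc 1 Q.natDegree, i ((hasseDeriv k Q).eval a) * (x - i a) ^ k := by
  have h1 : Q.eval₂ i x = (taylor a Q).eval₂ i (x - i a) := by
    rw [taylor_apply, eval₂_comp]
    simp
  rw [h1, eval₂_eq_sum_range, natDegree_taylor, Finset.range_eq_Ico, Finset.sum_eq_sum_Ico_succ_bot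
    (by omega), taylor_coeff_zero, pow_zero, mul_one]
  congr 1
  refine Finset.sum_congr (by ext; simp) fun k _ ↦ by rw [taylor_coeff]

theorem eval_eq_sum_hasseDeriv (Q : F[X]) (a x : F) :
    Q.eval x = Q.eval a +
      ∑ k ∈ Finset.Icc 1 Q.natDegree, (hasseDeriv k Q).eval a * (x - a) ^ k := by
  simpa using eval₂_eq_sum_hasseDeriv (RingHom.id F) Q a x

theorem Valuation.IsLimit.eventually_dominated {δ : F → Γ} (hδ : w.IsLimit δ) {Q : F[X]}
    (hQ : Q ≠ 0) (h : ∀ k, w.IsStable δ (hasseDeriv k Q)) :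
    ∀ᶠ a in limitFilter δ, ∀ k, 1 ≤ k →
      w ((hasseDeriv k Q).eval a) * δ a ^ k < w (Q.eval a) := by
  have := hδ.neBot
  obtain ⟨γ, hγ⟩ := exists_stable_values (m := 0) fun k _ ↦ h k
  simp only [Nat.zero_le, true_imp_iff] at hγ
  set n := Q.natDegree with hn
  have hγn : γ n ≠ 0 := by
    obtain ⟨a, ha⟩ := hγ.exists
    rw [← ha n, hn, hasseDeriv_natDegree_eq_C, eval_C, w.ne_zero_iff]
    exact leadingCoeff_ne_zero.2 hQ
  have hsep : ∀ᶠ a in limitFilter δ, ∀ k ∈ Finset.range (n + 1), ∀ l ∈ Finset.range (n + 1),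
      k < l → γ k ≠ 0 → γ l ≠ 0 → γ k * δ a ^ k ≠ γ l * δ a ^ l := by
    refine (eventually_all_finset _).2 fun k _ ↦ (eventually_all_finset _).2 fun l _ ↦ ?_
    by_cases hex : ∃ a₀, k < l ∧ γ k ≠ 0 ∧ γ l ≠ 0 ∧ γ k * δ a₀ ^ k = γ l * δ a₀ ^ l
    · obtain ⟨a₀, hkl, hk, hl, e₀⟩ := hex
      filter_upwards [eventually_lt_limitFilter δ a₀] with a ha _ _ _ e
      have hpw : ∀ b, δ b ^ l = δ b ^ (l - k) * δ b ^ k := fun b ↦ by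
        rw [← pow_add]; congr 1; omega
      rw [hpw, ← mul_assoc] at e e₀
      have e1 := mul_right_cancel₀ (pow_ne_zero k (hδ.pos a).ne') e
      have e2 := mul_right_cancel₀ (pow_ne_zero k (hδ.pos a₀).ne') e₀
      have e3 := mul_left_cancel₀ hl (e1.symm.trans e2)
      exact (pow_lt_pow_left₀ ha zero_le (by omega)).ne e3
    · push Not at hex
      exact Eventually.of_forall fun a h1 h2 h3 ↦ hex a h1 h2 h3
  have hle : ∀ᶠ a in limitFilter δ, ∀ k ∈ Finset.Icc 1 n, γ k * δ a ^ k ≤ γ 0 := by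
    filter_upwards [hγ, hsep] with a ha hs k hk
    obtain ⟨a', ha', hlt⟩ := (hγ.and (eventually_lt_limitFilter δ a)).exists
    obtain ⟨j, hj, hmax⟩ := Finset.exists_max_image (Finset.Icc 1 n) (fun k ↦ γ k * δ a ^ k)
      ⟨k, hk⟩
    refine (hmax k hk).trans ?_
    have hn1 : n ∈ Finset.Icc 1 n := by
      rw [Finset.mem_Icc] at hk ⊢; omega
    have hjpos : 0 < γ j * δ a ^ j :=
      (zero_lt_iff.2 (mul_ne_zero hγn (pow_ne_zero n (hδ.pos a).ne'))).trans_le (hmax n hn1)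
    have hj0 : γ j ≠ 0 := left_ne_zero_of_mul hjpos.ne'
    have hval : ∀ l, w ((hasseDeriv l Q).eval a * (a' - a) ^ l) = γ l * δ a ^ l := fun l ↦ by
      rw [map_mul, map_pow, ha, hδ.dist a a' hlt]
    have hd : w (Q.eval a' - Q.eval a) = γ j * δ a ^ j := by
      rw [eval_eq_sum_hasseDeriv Q a a', add_sub_cancel_left, ← Finset.add_sum_erase _ _ hj,
        w.map_add_eq_of_lt_left, hval]
      rw [hval]
      refine w.map_sum_lt hjpos.ne' fun l hl ↦ ?_
      rw [hval]
      obtain ⟨hlj, hl⟩ := Finset.mem_erase.1 hl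
      refine lt_of_le_of_ne (hmax l hl) fun e ↦ ?_
      have hl0 : γ l ≠ 0 := by
        refine left_ne_zero_of_mul (b := δ a ^ l) ?_
        rw [e]; exact hjpos.ne'
      rw [Finset.mem_Icc] at hl hj
      rcases lt_or_gt_of_ne hlj with hlt | hlt
      · exact hs l (by simp; omega) j (by simp; omega) hlt hl0 hj0 e
      · exact hs j (by simp; omega) l (by simp; omega) hlt hj0 hl0 e.symm
    rw [← hd]
    refine w.map_sub_le ?_ ?_
    · rw [← ha' 0, hasseDeriv_zero]; rfl
    · rw [← ha 0, hasseDeriv_zero]; rfl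
  obtain ⟨a₁, ha₁⟩ := hle.exists
  have hγ0 : 0 < γ 0 := by
    rcases Nat.eq_zero_or_pos n with h0 | hpos
    · rw [← h0]
      exact zero_lt_iff.2 hγn
    · exact (zero_lt_iff.2 (mul_ne_zero hγn (pow_ne_zero n (hδ.pos a₁).ne'))).trans_le
        (ha₁ n (Finset.mem_Icc.2 ⟨hpos, le_rfl⟩))
  filter_upwards [hγ, eventually_lt_limitFilter δ a₁] with a ha hlt k hk
  have e0 : w (Q.eval a) = γ 0 := by
    rw [← ha 0, hasseDeriv_zero]; rfl
  rw [e0, ha]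
  by_cases hk0 : γ k = 0
  · rwa [hk0, zero_mul]
  · have hkn : k ≤ n := by
      by_contra hkn
      refine hk0 ?_
      rw [← ha k, hasseDeriv_eq_zero_of_lt_natDegree _ _ (not_le.1 hkn), eval_zero, map_zero]
    refine lt_of_lt_of_le ?_ (ha₁ k (Finset.mem_Icc.2 ⟨hk, hkn⟩))
    exact mul_lt_mul_of_pos_left (pow_lt_pow_left₀ hlt zero_le (by omega)) (zero_lt_iff.2 hk0)

theorem Valuation.IsLimit.eventually_eval₂_sub_lt {δ : F → Γ} (hδ : w.IsLimit δ)
    (hi : ∀ x, v (i x) = w x) {Q : F[X]}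
    (hQ : Q ≠ 0) (h : ∀ k, w.IsStable δ (hasseDeriv k Q)) {x : L}
    (hx : ∀ a, v (x - i a) = δ a) :
    ∀ᶠ a in limitFilter δ, v (Q.eval₂ i x - i (Q.eval a)) < w (Q.eval a) ∧
      v (Q.eval₂ i x) = w (Q.eval a) := by
  filter_upwards [hδ.eventually_dominated hQ h] with a ha
  have hpos : 0 < w (Q.eval a) := lt_of_le_of_lt zero_le (ha 1 le_rfl)
  have h1 : v (Q.eval₂ i x - i (Q.eval a)) < w (Q.eval a) := by
    rw [eval₂_eq_sum_hasseDeriv i Q a x, add_sub_cancel_left]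
    refine v.map_sum_lt hpos.ne' fun k hk ↦ ?_
    rw [map_mul, map_pow, hi, hx]
    exact ha k (Finset.mem_Icc.1 hk).1
  refine ⟨h1, ?_⟩
  have := v.map_add_eq_of_lt_left (h1.trans_eq (hi _).symm)
  rwa [add_sub_cancel, hi] at this

/-- Kaplansky's theorem on pseudo-limits of algebraic type. -/
theorem Valuation.IsLimit.exists_root {δ : F → Γ} (hδ : w.IsLimit δ)
    (hc : ∀ n : ℕ, n ≠ 0 → w (n : F) = 1)
    (hi : ∀ x, v (i x) = w x) (hv : v.IsHensel) {Q : F[X]}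
    (hlt : ∀ R : F[X], R.natDegree < Q.natDegree → w.IsStable δ R)
    (hQ : ¬ w.IsStable δ Q) :
    ∃ x : L, Q.eval₂ i x = 0 ∧ ∀ a, v (x - i a) = δ a := by
  have := hδ.neBot
  set n := Q.natDegree with hn
  have hchar : ∀ m : ℕ, m ≠ 0 → (m : F) ≠ 0 := fun m hm h0 ↦ by
    have := hc m hm
    rw [h0, map_zero] at this
    exact zero_ne_one this
  have hn0 : 0 < n := by
    by_contra h0
    refine hQ ⟨w (Q.coeff 0), Eventually.of_forall fun a ↦ ?_⟩
    rw [eq_C_of_natDegree_eq_zero (by omega : Q.natDegree = 0)]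
    simp
  have hstab : ∀ k, 1 ≤ k → w.IsStable δ (hasseDeriv k Q) := fun k hk ↦ hlt _ (by
    have := natDegree_hasseDeriv_le Q k
    omega)
  have hcomp : ∀ k, hasseDeriv k (hasseDeriv 1 Q) = (k + 1) • hasseDeriv (k + 1) Q := by
    intro k
    have := congrArg (fun f ↦ f Q) (hasseDeriv_comp (R := F) k 1)
    simpa [add_mul] using this
  have hD0 : hasseDeriv 1 Q ≠ 0 := by
    intro h0
    have h1 : (hasseDeriv 1 Q).coeff (n - 1) = 0 := by rw [h0, coeff_zero]
    rw [hasseDeriv_coeff, Nat.sub_add_cancel hn0, Nat.choose_one_right, hn, coeff_natDegree] at h1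
    refine (mul_ne_zero (hchar _ (by omega)) (leadingCoeff_ne_zero.2 ?_)) h1
    rintro rfl
    simp [hn] at hn0
  obtain ⟨γ, hγ⟩ := exists_stable_values (m := 1) hstab
  have hdom : ∀ᶠ a in limitFilter δ, ∀ k, 2 ≤ k → γ k * δ a ^ (k - 1) < γ 1 := by
    have h1 := hδ.eventually_dominated hD0 fun k ↦ by
      refine hlt _ ?_
      have h1 := natDegree_hasseDeriv_le (hasseDeriv 1 Q) k
      have h2 := natDegree_hasseDeriv_le Q 1
      omega
    filter_upwards [h1, hγ] with a ha hγa k hk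
    have := ha (k - 1) (by omega)
    rw [hcomp, Nat.sub_add_cancel (by omega), nsmul_eq_mul, eval_mul, map_mul, eval_natCast,
      hc k (by omega), one_mul, hγa k (by omega), hγa 1 le_rfl] at this
    exact this
  have hγ1 : 0 < γ 1 := by
    obtain ⟨a, ha⟩ := hdom.exists
    exact lt_of_le_of_lt zero_le (ha 2 le_rfl)
  have hterm : ∀ a, (∀ k, 2 ≤ k → γ k * δ a ^ (k - 1) < γ 1) → ∀ γ', γ' ≤ δ a → γ' ≠ 0 →
      ∀ k, 2 ≤ k → γ k * γ' ^ k < γ 1 * γ' := by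
    intro a ha γ' hγ' h0 k hk
    have e : γ' ^ k = γ' ^ (k - 1) * γ' := by rw [← pow_succ]; congr 1; omega
    rw [e, ← mul_assoc]
    refine mul_lt_mul_of_pos_right (lt_of_le_of_lt ?_ (ha k hk)) (zero_lt_iff.2 h0)
    exact mul_le_mul_right (pow_le_pow_left₀ zero_le hγ' _) _
  have hval : ∀ᶠ a in limitFilter δ, w (Q.eval a) ≤ γ 1 * δ a := by
    filter_upwards [hγ, hdom] with a hγa ha
    by_contra hgt
    push Not at hgt
    refine hQ ⟨w (Q.eval a), ?_⟩
    filter_upwards [eventually_lt_limitFilter δ a] with a' ha'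
    rw [eval_eq_sum_hasseDeriv Q a a']
    refine w.map_add_eq_of_lt_left ?_
    refine lt_of_le_of_lt (w.map_sum_le (g := γ 1 * δ a) fun k hk ↦ ?_) hgt
    have hk1 := (Finset.mem_Icc.1 hk).1
    rw [map_mul, map_pow, hγa k hk1, hδ.dist a a' ha']
    rcases eq_or_lt_of_le hk1 with rfl | hk2
    · rw [pow_one]
    · exact (hterm a ha (δ a) le_rfl (hδ.pos a).ne' k hk2).le
  obtain ⟨a, ⟨hγa, hda⟩, hva⟩ := ((hγ.and hdom).and hval).exists
  obtain ⟨b, hb⟩ := hδ.no_min a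
  have hs : v (i (b - a)) = δ a := by rw [hi, hδ.dist a b hb]
  have hcoeff : ∀ k, (taylor (i a) (Q.map i)).coeff k = i ((hasseDeriv k Q).eval a) := by
    intro k
    have e : hasseDeriv k (Q.map i) = (hasseDeriv k Q).map i := by
      ext m
      simp [hasseDeriv_coeff]
    rw [taylor_coeff, e, eval_map, eval₂_at_apply]
  obtain ⟨y, hy, hy0⟩ := hv.exists_root (taylor (i a) (Q.map i)) (s := i (b - a))
    (by rw [← v.ne_zero_iff, hs]; exact (hδ.pos a).ne')
    (by rw [hcoeff, ← v.ne_zero_iff, hi, hγa 1 le_rfl]; exact hγ1.ne')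
    (by rw [hcoeff, hcoeff, hs, hi, hi, hγa 1 le_rfl, hasseDeriv_zero]; exact hva)
    (fun k hk ↦ by
      rw [hcoeff, hcoeff, hs, hi, hi, hγa 1 le_rfl, hγa k (by omega)]
      exact hterm a hda (δ a) le_rfl (hδ.pos a).ne' k hk)
  rw [hs] at hy
  rw [taylor_eval, eval_map] at hy0
  set x := y + i a with hx
  have hclose : ∀ᶠ a' in limitFilter δ, v (x - i a') ≤ δ a' := by
    filter_upwards [hγ, hval, eventually_lt_limitFilter δ a] with a' hγ' hv' hlt'
    by_contra hgt
    push Not at hgt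
    set z := x - i a' with hz
    have hz0 : v z ≠ 0 := (lt_of_le_of_lt zero_le hgt).ne'
    have hza : v z ≤ δ a := by
      have e : z = y + i (a - a') := by rw [hz, hx, RingHom.map_sub]; ring
      rw [e]
      refine v.map_add_le hy ?_
      rw [hi, w.map_sub_swap, hδ.dist a a' hlt']
    have hsum := eval₂_eq_sum_hasseDeriv i Q a' x
    have h1n : 1 ∈ Finset.Icc 1 Q.natDegree := Finset.mem_Icc.2 ⟨le_rfl, hn0⟩
    rw [hy0, ← Finset.add_sum_erase _ _ h1n, ← hz, pow_one] at hsum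
    have hv1 : v (i ((hasseDeriv 1 Q).eval a') * z) = γ 1 * v z := by
      rw [map_mul, hi, hγ' 1 le_rfl]
    have hrest : v (i (Q.eval a') + ∑ k ∈ (Finset.Icc 1 Q.natDegree).erase 1,
        i ((hasseDeriv k Q).eval a') * z ^ k) < γ 1 * v z := by
      refine v.map_add_lt ?_ (v.map_sum_lt (mul_ne_zero hγ1.ne' hz0) fun k hk ↦ ?_)
      · rw [hi]
        exact hv'.trans_lt (mul_lt_mul_of_pos_left hgt hγ1)
      · rw [Finset.mem_erase, Finset.mem_Icc] at hk
        rw [map_mul, map_pow, hi, hγ' k hk.2.1]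
        exact hterm a hda (v z) hza hz0 k (by omega)
    rw [← hv1] at hrest
    have h3 := v.map_add_eq_of_lt_left hrest
    rw [add_left_comm, ← hsum, map_zero, hv1] at h3
    exact mul_ne_zero hγ1.ne' hz0 h3.symm
  refine ⟨x, hy0, fun c ↦ ?_⟩
  obtain ⟨a', ha', hlt'⟩ := (hclose.and (eventually_lt_limitFilter δ c)).exists
  have e : x - i c = i (a' - c) + (x - i a') := by rw [RingHom.map_sub]; ring
  have h1 : v (i (a' - c)) = δ c := by rw [hi, hδ.dist c a' hlt']
  rw [e, v.map_add_eq_of_lt_left (by rw [h1]; exact ha'.trans_lt hlt'), h1]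

end Limit

section Maximal

universe u

variable {J : Type} {K : J → Type u} [∀ j, Field (K j)] {Γ : Type*}
  [LinearOrderedCommGroupWithZero Γ]

/-- `F` is maximal among the fields with compatible embeddings in the `K j`, such that all ratios
of elements of `F` of value one lie in the subrings `B j`. -/
structure IsMaximalExt (v : ∀ j, Valuation (K j) Γ) (B : ∀ j, Subring (K j)) {F : Type*} [Field F]
    (i : ∀ j, F →+* K j) (w : Valuation F Γ) : Prop where
  val : ∀ j x, v j (i j x) = w x
  ratio : ∀ j x, w x = 1 → i j x ∈ B j
  maximal : ∀ b : ∀ j, K j,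
    (∀ (Q : F[X]) (j j' : J), v j (Q.eval₂ (i j) (b j)) = v j' (Q.eval₂ (i j') (b j'))) →
    (∀ (Q Q' : F[X]) (j : J), v j (Q.eval₂ (i j) (b j)) = v j (Q'.eval₂ (i j) (b j)) →
      v j (Q'.eval₂ (i j) (b j)) ≠ 0 → Q.eval₂ (i j) (b j) / Q'.eval₂ (i j) (b j) ∈ B j) →
    ∃ a, ∀ j, i j a = b j

/-- A subring of a product of valued fields on which the valuations agree, and whose ratios of
value one lie in given subrings. -/
structure IsCompatible (v : ∀ j, Valuation (K j) Γ) (B : ∀ j, Subring (K j))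
    (G : Subring (∀ j, K j)) : Prop where
  val : ∀ p ∈ G, ∀ j j', v j (p j) = v j' (p j')
  ratio : ∀ p ∈ G, ∀ q ∈ G, ∀ j, v j (p j) = v j (q j) → v j (q j) ≠ 0 → p j / q j ∈ B j

variable {v : ∀ j, Valuation (K j) Γ} {B : ∀ j, Subring (K j)}

/-- The subring of fractions of elements of `G`. -/
def fractionSubring (G : Subring (∀ j, K j)) : Subring (∀ j, K j) where
  carrier := {p | ∃ s ∈ G, (∀ j, s j ≠ 0) ∧ p * s ∈ G}
  one_mem' := ⟨1, G.one_mem, fun j ↦ one_ne_zero, by simp⟩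
  zero_mem' := ⟨1, G.one_mem, fun j ↦ one_ne_zero, by simp⟩
  neg_mem' := by
    rintro p ⟨s, hs, hs0, hps⟩
    exact ⟨s, hs, hs0, by simpa [neg_mul] using G.neg_mem hps⟩
  mul_mem' := by
    rintro p q ⟨s, hs, hs0, hps⟩ ⟨t, ht, ht0, hqt⟩
    refine ⟨s * t, G.mul_mem hs ht, fun j ↦ mul_ne_zero (hs0 j) (ht0 j), ?_⟩
    rw [mul_mul_mul_comm]
    exact G.mul_mem hps hqt
  add_mem' := by
    rintro p q ⟨s, hs, hs0, hps⟩ ⟨t, ht, ht0, hqt⟩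
    refine ⟨s * t, G.mul_mem hs ht, fun j ↦ mul_ne_zero (hs0 j) (ht0 j), ?_⟩
    have : (p + q) * (s * t) = p * s * t + q * t * s := by ring
    rw [this]
    exact G.add_mem (G.mul_mem hps ht) (G.mul_mem hqt hs)

theorem IsCompatible.fractionSubring {G : Subring (∀ j, K j)} (hG : IsCompatible v B G) :
    IsCompatible v B (fractionSubring G) where
  val := by
    rintro p ⟨s, hs, hs0, hps⟩ j j'
    have h1 := hG.val _ hps j j'
    rw [Pi.mul_apply, Pi.mul_apply, map_mul, map_mul, hG.val s hs j j'] at h1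
    exact mul_right_cancel₀ ((v j').ne_zero_iff.2 (hs0 j')) h1
  ratio := by
    rintro p ⟨s, hs, hs0, hps⟩ q ⟨t, ht, ht0, hqt⟩ j h h0
    have h1 := hG.ratio _ (G.mul_mem hps ht) _ (G.mul_mem hqt hs) j
      (by simp only [Pi.mul_apply, map_mul, h]; exact mul_right_comm _ _ _)
      (by
        simp only [Pi.mul_apply, map_mul]
        exact mul_ne_zero (mul_ne_zero h0 ((v j).ne_zero_iff.2 (ht0 j)))
          ((v j).ne_zero_iff.2 (hs0 j)))
    have h2 : q j ≠ 0 := (v j).ne_zero_iff.1 h0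
    have e : (p * s * t) j / (q * t * s) j = p j / q j := by
      have := hs0 j
      have := ht0 j
      simp only [Pi.mul_apply]
      field_simp
    rwa [e] at h1

theorem IsCompatible.exists_maximal {G₀ : Subring (∀ j, K j)} (h₀ : IsCompatible v B G₀) :
    ∃ G, G₀ ≤ G ∧ Maximal (IsCompatible v B) G := by
  refine zorn_le_nonempty₀ {G | IsCompatible v B G} (fun c hc hchain G hG ↦ ?_) G₀ h₀
  have hdir : DirectedOn (· ≤ ·) c := hchain.directedOn
  have hmem : ∀ {p}, p ∈ sSup c ↔ ∃ G ∈ c, p ∈ G := Subring.mem_sSup_of_directedOn ⟨G, hG⟩ hdir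
  refine ⟨sSup c, ⟨fun p hp ↦ ?_, fun p hp q hq ↦ ?_⟩, fun _ h ↦ le_sSup h⟩
  · obtain ⟨H, hH, hpH⟩ := hmem.1 hp
    exact (hc hH).val p hpH
  · obtain ⟨H, hH, hpH⟩ := hmem.1 hp
    obtain ⟨H', hH', hqH⟩ := hmem.1 hq
    obtain ⟨H'', hH'', h1, h2⟩ := hdir H hH H' hH'
    exact (hc hH'').ratio p (h1 hpH) q (h2 hqH)

theorem exists_isMaximalExt [Nonempty J] {R : Type*} [CommRing R] (f : ∀ j, R →+* K j)
    (hval : ∀ r j j', v j (f j r) = v j' (f j' r))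
    (hratio : ∀ r s j, v j (f j r) = v j (f j s) → v j (f j s) ≠ 0 → f j r / f j s ∈ B j) :
    ∃ (F : Type u) (_ : Field F) (i : ∀ j, F →+* K j) (w : Valuation F Γ),
      IsMaximalExt v B i w ∧ ∃ g : R →+* F, ∀ j r, i j (g r) = f j r := by
  obtain ⟨G, hG₀, hG⟩ := IsCompatible.exists_maximal (v := v) (B := B)
    (G₀ := (RingHom.pi f).range) ⟨by rintro _ ⟨r, rfl⟩ j j'; exact hval r j j',
      by rintro _ ⟨r, rfl⟩ _ ⟨s, rfl⟩ j; exact hratio r s j⟩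
  obtain ⟨j₀⟩ := ‹Nonempty J›
  have hinv : ∀ p : ∀ j, K j, p ∈ fractionSubring G → p ∈ G := by
    refine hG.le_of_ge hG.prop.fractionSubring fun p hp ↦ ⟨1, G.one_mem, ?_, by simpa using hp⟩
    exact fun j ↦ one_ne_zero
  have hne : ∀ p ∈ G, p ≠ 0 → ∀ j, p j ≠ 0 := by
    intro p hp hp0 j hj
    refine hp0 (funext fun j' ↦ ?_)
    rw [Pi.zero_apply, ← (v j').zero_iff, hG.prop.val p hp j' j, hj, map_zero]
  have hfield : IsField G := by
    refine ⟨⟨0, 1, fun h ↦ zero_ne_one' (K j₀) ?_⟩, mul_comm, fun {p} hp ↦ ?_⟩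
    · exact congrFun (congrArg Subtype.val h) j₀
    · have hp' := hne p.1 p.2 fun h ↦ hp (Subtype.ext h)
      have h1 : (p.1 * fun j ↦ (p.1 j)⁻¹) = 1 := funext fun j ↦ mul_inv_cancel₀ (hp' j)
      refine ⟨⟨fun j ↦ (p.1 j)⁻¹, hinv _ ⟨p.1, p.2, hp', ?_⟩⟩, Subtype.ext h1⟩
      rw [mul_comm, h1]
      exact G.one_mem
  let _ : Field G := hfield.toField
  let i : ∀ j, G →+* K j := fun j ↦ (Pi.evalRingHom K j).comp G.subtype
  have hval' : ∀ j x, v j (i j x) = (v j₀).comap (i j₀) x := fun j x ↦ hG.prop.val x.1 x.2 j j₀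
  refine ⟨G, inferInstance, i, (v j₀).comap (i j₀), ⟨hval', ?_, ?_⟩, ?_⟩
  · intro j x hx
    rw [← hval' j] at hx
    have := hG.prop.ratio x.1 x.2 1 G.one_mem j (by rw [Pi.one_apply, map_one]; exact hx) (by simp)
    rwa [Pi.one_apply, div_one] at this
  · intro b hb hb'
    let e : G[X] →+* ∀ j, K j := RingHom.pi fun j ↦ eval₂RingHom (i j) (b j)
    have hle : e.range ≤ G := by
      refine hG.le_of_ge ⟨?_, ?_⟩ fun p hp ↦ ⟨C ⟨p, hp⟩, funext fun j ↦ ?_⟩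
      · rintro _ ⟨Q, rfl⟩ j j'
        exact hb Q j j'
      · rintro _ ⟨Q, rfl⟩ _ ⟨Q', rfl⟩ j
        exact hb' Q Q' j
      · exact eval₂_C _ _
    have hbG : b ∈ G := hle ⟨X, funext fun j ↦ eval₂_X _ _⟩
    exact ⟨⟨b, hbG⟩, fun j ↦ rfl⟩
  · exact ⟨(RingHom.pi f).codRestrict G fun r ↦ hG₀ ⟨r, rfl⟩, fun j r ↦ rfl⟩

variable {F : Type*} [Field F] {i : ∀ j, F →+* K j} {w : Valuation F Γ}

theorem IsMaximalExt.exists_eq (h : IsMaximalExt v B i w) (D : F[X] → Prop) (b : ∀ j, K j)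
    (hD : ∀ Q : F[X], ∃ Q' : F[X], D Q' ∧ ∀ j, Q'.eval₂ (i j) (b j) = Q.eval₂ (i j) (b j))
    (hval : ∀ Q : F[X], D Q → Q ≠ 0 → ∃ γ, ∀ j, v j (Q.eval₂ (i j) (b j)) = γ)
    (hratio : ∀ Q Q' : F[X], D Q → D Q' → Q ≠ 0 → Q' ≠ 0 → ∀ j,
      v j (Q.eval₂ (i j) (b j)) = v j (Q'.eval₂ (i j) (b j)) →
        Q.eval₂ (i j) (b j) / Q'.eval₂ (i j) (b j) ∈ B j) :
    ∃ a, ∀ j, i j a = b j := by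
  refine h.maximal b (fun Q j j' ↦ ?_) fun Q Q' j he h0 ↦ ?_
  · obtain ⟨Q', hQ', e⟩ := hD Q
    rw [← e, ← e]
    by_cases h0 : Q' = 0
    · simp [h0]
    · obtain ⟨γ, hγ⟩ := hval Q' hQ' h0
      rw [hγ, hγ]
  · obtain ⟨R, hR, e⟩ := hD Q
    obtain ⟨R', hR', e'⟩ := hD Q'
    rw [← e, ← e'] at he ⊢
    rw [← e'] at h0
    refine hratio R R' hR hR' ?_ ?_ j he
    · rintro rfl
      rw [← he, eval₂_zero, map_zero] at h0
      exact h0 rfl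
    · rintro rfl
      rw [eval₂_zero, map_zero] at h0
      exact h0 rfl

theorem IsMaximalExt.exists_eq_of_root (h : IsMaximalExt v B i w) (b : ∀ j, K j) {P : F[X]}
    (hP : P.Monic) (hP1 : 0 < P.natDegree) (hb : ∀ j, P.eval₂ (i j) (b j) = 0)
    (hval : ∀ Q : F[X], Q.natDegree < P.natDegree → Q ≠ 0 → ∃ γ, ∀ j,
      v j (Q.eval₂ (i j) (b j)) = γ)
    (hratio : ∀ Q Q' : F[X], Q.natDegree < P.natDegree → Q'.natDegree < P.natDegree → Q ≠ 0 →
      Q' ≠ 0 → ∀ j, v j (Q.eval₂ (i j) (b j)) = v j (Q'.eval₂ (i j) (b j)) →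
        Q.eval₂ (i j) (b j) / Q'.eval₂ (i j) (b j) ∈ B j) :
    ∃ a, ∀ j, i j a = b j :=
  h.exists_eq (fun Q ↦ Q.natDegree < P.natDegree) b
    (fun Q ↦ ⟨Q %ₘ P, natDegree_modByMonic_lt Q hP (by rintro rfl; simp at hP1),
      fun j ↦ eval₂_modByMonic_eq_self_of_root (hb j)⟩) hval hratio

end Maximal

section ResiduePreimage

variable {K Γ : Type*} [Field K] [LinearOrderedCommGroupWithZero Γ] {v : Valuation K Γ}
  {B : Subring K}

theorem Valuation.IsResiduePreimage.mem_of_sub_mem (hB : v.IsResiduePreimage B) {x y : K}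
    (h : v (x - y) < 1) (hy : y ∈ B) : x ∈ B := by
  have := B.add_mem (hB.mem_of_lt_one _ h) hy
  rwa [sub_add_cancel] at this

theorem Valuation.IsResiduePreimage.div_mem (hB : v.IsResiduePreimage B) {p q t t' : K}
    (hp : v (p - t) < v p) (hq : v (q - t') < v q) (h : v p = v q) (ht : t / t' ∈ B) :
    p / q ∈ B :=
  hB.mem_of_sub_mem (v.map_div_sub_div_lt_one hp hq h) ht

theorem Subring.prod_sub_mem {F : Type*} {B : Subring K} {u : K} (hu : u ∈ B) {f : F → K}
    {s : Multiset F} (hs : ∀ c ∈ s, f c ∈ B) : (s.map fun c ↦ u - f c).prod ∈ B := by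
  refine B.multiset_prod_mem _ fun x hx ↦ ?_
  obtain ⟨c, hc, rfl⟩ := Multiset.mem_map.1 hx
  exact B.sub_mem hu (hs c hc)

end ResiduePreimage

section Maximal

universe u

variable {J : Type} {K : J → Type u} [∀ j, Field (K j)] {Γ : Type*}
  [LinearOrderedCommGroupWithZero Γ] {v : ∀ j, Valuation (K j) Γ} {B : ∀ j, Subring (K j)}
  {F : Type*} [Field F] {i : ∀ j, F →+* K j} {w : Valuation F Γ}

theorem IsMaximalExt.div_mem (h : IsMaximalExt v B i w) {x y : F} (hxy : w x = w y) (hy : y ≠ 0)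
    (j : J) : i j x / i j y ∈ B j := by
  rw [← map_div₀]
  refine h.ratio j _ ?_
  rw [map_div₀, hxy, div_self (w.ne_zero_iff.2 hy)]

theorem IsMaximalExt.mem_of_le_one (h : IsMaximalExt v B i w)
    (hB : ∀ j, (v j).IsResiduePreimage (B j)) {x : F} (hx : w x ≤ 1) (j : J) : i j x ∈ B j := by
  rcases hx.eq_or_lt with h1 | h1
  · exact h.ratio j x h1
  · exact (hB j).mem_of_lt_one _ (by rwa [h.val])

theorem IsMaximalExt.div_mem_of_value (h : IsMaximalExt v B i w)
    (hB : ∀ j, (v j).IsResiduePreimage (B j)) {γ : Γ} (hγ : γ ≠ 0) {Q Q' : F[X]} (hQ : Q ≠ 0)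
    (hQ' : Q' ≠ 0)
    (hno : ∀ k, 0 < k → k ≤ max Q.natDegree Q'.natDegree → ∀ c, w c ≠ γ ^ k) {j : J} {b : K j}
    (hb : v j b = γ) (he : v j (Q.eval₂ (i j) b) = v j (Q'.eval₂ (i j) b)) :
    Q.eval₂ (i j) b / Q'.eval₂ (i j) b ∈ B j := by
  obtain ⟨k, hk, hk0, hkd⟩ := exists_monomial_dominant (w := w) hγ hQ
    fun k h1 h2 ↦ hno k h1 (h2.trans (le_max_left _ _))
  obtain ⟨l, hl, hl0, hld⟩ := exists_monomial_dominant (w := w) hγ hQ'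
    fun k h1 h2 ↦ hno k h1 (h2.trans (le_max_right _ _))
  obtain ⟨h1, h2⟩ := map_eval₂_of_monomial_dominant (h.val j) hγ hk hk0 hkd hb
  obtain ⟨h3, h4⟩ := map_eval₂_of_monomial_dominant (h.val j) hγ hl hl0 hld hb
  have key : ∀ (x y : F) (r s : ℕ), y ≠ 0 → r < s → s ≤ max Q.natDegree Q'.natDegree →
      w x * γ ^ r ≠ w y * γ ^ s := by
    intro x y r s hy hrs hs e
    refine hno (s - r) (by omega) (by omega) (x / y) ?_
    have : γ ^ s = γ ^ (s - r) * γ ^ r := by rw [← pow_add]; congr 1; omega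
    rw [this, ← mul_assoc] at e
    rw [map_div₀, div_eq_iff (w.ne_zero_iff.2 hy), mul_right_cancel₀ (pow_ne_zero r hγ) e, mul_comm]
  have hval := he
  rw [h2, h4] at hval
  have hkl : k = l := by
    rcases lt_trichotomy k l with hlt | hlt | hlt
    · exact absurd hval (key _ _ k l hl0 hlt (hl.trans (le_max_right _ _)))
    · exact hlt
    · exact absurd hval.symm (key _ _ l k hk0 hlt (hk.trans (le_max_left _ _)))
  subst hkl
  refine (hB j).div_mem h1 h3 he ?_
  have hb0 : b ≠ 0 := by rw [← (v j).ne_zero_iff, hb]; exact hγ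
  rw [mul_div_mul_right _ _ (pow_ne_zero k hb0)]
  exact h.div_mem (mul_right_cancel₀ (pow_ne_zero k hγ) hval) hl0 j

theorem IsMaximalExt.surjective [Nonempty J] (h : IsMaximalExt v B i w) (hv : ∀ j, (v j).IsTame)
    (hB : ∀ j, (v j).IsResiduePreimage (B j)) : Function.Surjective w := by
  classical
  intro γ
  by_cases hγ : γ = 0
  · exact ⟨0, by rw [map_zero, hγ]⟩
  suffices ∃ b : ∀ j, K j, (∀ j, v j (b j) = γ) ∧ ∃ a, ∀ j, i j a = b j by
    obtain ⟨b, hb, a, ha⟩ := this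
    obtain ⟨j⟩ := ‹Nonempty J›
    exact ⟨a, by rw [← h.val j, ha, hb]⟩
  by_cases hex : ∃ m, 0 < m ∧ ∃ c, w c = γ ^ m
  · obtain ⟨hm, c, hc⟩ := Nat.find_spec hex
    have hmin : ∀ k, 0 < k → k < Nat.find hex → ∀ c, w c ≠ γ ^ k := fun k hk hkm c hc ↦
      Nat.find_min hex hkm ⟨hk, c, hc⟩
    set m := Nat.find hex
    have : ∀ j, ∃ b, v j b = γ ∧ b ^ m = i j c := fun j ↦
      (hv j).exists_pow_eq hm.ne' hγ (by rw [h.val, hc])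
    choose b hb hbm using this
    have hdeg : (X ^ m - C c).natDegree = m := natDegree_X_pow_sub_C
    refine ⟨b, hb, h.exists_eq_of_root b (P := X ^ m - C c) (monic_X_pow_sub_C c hm.ne')
      (by rwa [hdeg]) (fun j ↦ by simp [hbm]) (fun Q hQ hQ0 ↦ ?_)
      fun Q Q' hQ hQ' hQ0 hQ0' j he ↦ h.div_mem_of_value hB hγ hQ0 hQ0' ?_ (hb j) he⟩
    · rw [hdeg] at hQ
      obtain ⟨k, hk, hk0, hkd⟩ := exists_monomial_dominant (w := w) hγ hQ0
        fun k h1 h2 ↦ hmin k h1 (by omega)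
      exact ⟨_, fun j ↦ (map_eval₂_of_monomial_dominant (h.val j) hγ hk hk0 hkd (hb j)).2⟩
    · rw [hdeg] at hQ hQ'
      exact fun k h1 h2 ↦ hmin k h1 (h2.trans_lt (max_lt hQ hQ'))
  · have hno : ∀ k, 0 < k → ∀ c, w c ≠ γ ^ k := fun k hk c hc ↦ hex ⟨k, hk, c, hc⟩
    have : ∀ j, ∃ b, v j b = γ := fun j ↦ (hv j).surj γ
    choose b hb using this
    refine ⟨b, hb, h.exists_eq (fun _ ↦ True) b (fun Q ↦ ⟨Q, trivial, fun _ ↦ rfl⟩)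
      (fun Q _ hQ0 ↦ ?_)
      fun Q Q' _ _ hQ0 hQ0' j he ↦ h.div_mem_of_value hB hγ hQ0 hQ0' ?_ (hb j) he⟩
    · obtain ⟨k, hk, hk0, hkd⟩ := exists_monomial_dominant (w := w) hγ hQ0
        fun k h1 _ ↦ hno k h1
      exact ⟨_, fun j ↦ (map_eval₂_of_monomial_dominant (h.val j) hγ hk hk0 hkd (hb j)).2⟩
    · exact fun k h1 _ ↦ hno k h1

/-- Elements of the `B j` whose residues are not residues of elements of `F`, and are not roots
of polynomials of small degree, can be adjoined. -/
theorem IsMaximalExt.unit_ratio (h : IsMaximalExt v B i w)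
    (hB : ∀ j, (v j).IsResiduePreimage (B j)) {Q Q' : F[X]} {d d' : F} (hd : d ≠ 0) (hd' : d' ≠ 0)
    {s s' : Multiset F} (hs : ∀ c ∈ s, w c ≤ 1) (hs' : ∀ c ∈ s', w c ≤ 1)
    (hQ : ∀ k, w ((Q - C d * (s.map fun c ↦ X - C c).prod).coeff k) < w d)
    (hQ' : ∀ k, w ((Q' - C d' * (s'.map fun c ↦ X - C c).prod).coeff k) < w d')
    {j : J} {u : K j} (hu : u ∈ B j) (huc : ∀ c, w c ≤ 1 → v j (u - i j c) = 1)
    (he : v j (Q.eval₂ (i j) u) = v j (Q'.eval₂ (i j) u)) :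
    Q.eval₂ (i j) u / Q'.eval₂ (i j) u ∈ B j := by
  obtain ⟨h1, h2, h3⟩ := map_eval₂_of_approx_factorization (h.val j) hd hQ ((hB j).le_one u hu)
    fun c hc ↦ huc c (hs c hc)
  obtain ⟨h1', h2', h3'⟩ := map_eval₂_of_approx_factorization (h.val j) hd' hQ'
    ((hB j).le_one u hu) fun c hc ↦ huc c (hs' c hc)
  refine (hB j).div_mem h2 h2' he ?_
  rw [mul_div_mul_comm]
  refine (B j).mul_mem (h.div_mem (by rw [← h1, ← h1', he]) hd' j) ?_
  rw [div_eq_mul_inv]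
  exact (B j).mul_mem (Subring.prod_sub_mem hu fun c hc ↦ h.mem_of_le_one hB (hs c hc) j)
    ((hB j).inv_mem _ (Subring.prod_sub_mem hu fun c hc ↦ h.mem_of_le_one hB (hs' c hc) j) h3')

theorem Valuation.map_sub_eq_one_of_near {K : Type*} [Field K] {v : Valuation K Γ} {x y c : K}
    (hxy : v (y - x) < 1) (hx : v (x - c) = 1) : v (y - c) = 1 := by
  have e : y - c = (x - c) + (y - x) := by ring
  rw [e, v.map_add_eq_of_lt_left (by rwa [hx]), hx]

theorem Valuation.map_eval_lt_one_of_near {K : Type*} [Field K] {v : Valuation K Γ} {p : K[X]}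
    (hp : ∀ k, v (p.coeff k) ≤ 1) {x c : K} (hx : v x ≤ 1) (hxc : v (c - x) < 1)
    (h : v (p.eval x) < 1) : v (p.eval c) < 1 := by
  rw [eval_eq_sum_hasseDeriv p x c]
  refine v.map_add_lt h (v.map_sum_lt one_ne_zero fun k hk ↦ ?_)
  rw [map_mul, map_pow]
  refine (mul_le_of_le_one_left'
    (v.map_eval_le_one (v.map_hasseDeriv_coeff_le_one hp k) hx)).trans_lt
    ?_
  exact pow_lt_one₀ zero_le hxc (by have := (Finset.mem_Icc.1 hk).1; omega)

theorem IsMaximalExt.hasResidueRoots [Nonempty J] (h : IsMaximalExt v B i w)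
    (hv : ∀ j, (v j).IsTame) (hB : ∀ j, (v j).IsResiduePreimage (B j)) :
    w.HasResidueRoots w.integer := by
  classical
  obtain ⟨j₀⟩ := ‹Nonempty J›
  by_contra hno
  have hex : ∃ m, ∃ p : F[X], p.natDegree = m ∧ p.Monic ∧ 0 < p.natDegree ∧
      (∀ k, w (p.coeff k) ≤ 1) ∧ ∀ x, w x ≤ 1 → 1 ≤ w (p.eval x) := by
    rw [Valuation.HasResidueRoots] at hno
    push Not at hno
    obtain ⟨p, h1, h2, h3, h4⟩ := hno
    exact ⟨_, p, rfl, h1, h2, h3, h4⟩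
  obtain ⟨p, hpm, hp, hp0, hpc, hpr⟩ := Nat.find_spec hex
  have hmin : ∀ q : F[X], q.Monic → 0 < q.natDegree → q.natDegree < p.natDegree →
      (∀ k, w (q.coeff k) ≤ 1) → ∃ x, w x ≤ 1 ∧ w (q.eval x) < 1 := by
    intro q h1 h2 h3 h4
    by_contra hc
    push Not at hc
    exact Nat.find_min hex (hpm ▸ h3) ⟨q, rfl, h1, h2, h4, hc⟩
  have hfac : ∀ Q : F[X], Q.natDegree < p.natDegree → Q ≠ 0 → ∃ d : F, d ≠ 0 ∧ ∃ s : Multiset F,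
      (∀ c ∈ s, w c ≤ 1) ∧
        ∀ k, w ((Q - C d * (s.map fun c ↦ X - C c).prod).coeff k) < w d := fun Q hQ hQ0 ↦
    w.exists_approx_factorization p.natDegree hmin Q.natDegree Q hQ0 rfl hQ
  have hcoeff : ∀ j k, v j ((p.map (i j)).coeff k) ≤ 1 := fun j k ↦ by
    rw [coeff_map, h.val]
    exact hpc k
  have hchar : ∀ n : ℕ, n ≠ 0 → w n = 1 := fun n hn ↦ by
    rw [← h.val j₀, map_natCast, (hv j₀).natCast n hn]
  have hroot : ∀ j, ∃ y ∈ B j, p.eval₂ (i j) y = 0 ∧ ∀ c, w c ≤ 1 → v j (y - i j c) = 1 := by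
    intro j
    obtain ⟨u, hu, hpu⟩ := (hB j).roots (p.map (i j)) (hp.map _) (by rwa [natDegree_map])
      fun k ↦ by
        rw [coeff_map]
        exact h.mem_of_le_one hB (hpc k) j
    have hu1 := (hB j).le_one u hu
    have huc : ∀ c, w c ≤ 1 → v j (u - i j c) = 1 := by
      intro c hc
      refine le_antisymm ((v j).map_sub_le hu1 (by rwa [h.val])) ?_
      by_contra hlt
      push Not at hlt
      have := (v j).map_eval_lt_one_of_near (hcoeff j) hu1
        (c := i j c) (by rwa [(v j).map_sub_swap]) hpu
      rw [eval_map, eval₂_at_apply, h.val] at this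
      exact (hpr c hc).not_gt this
    have hder : p.derivative.coeff (p.natDegree - 1) = (p.natDegree : F) := by
      rw [coeff_derivative, Nat.sub_add_cancel hp0, coeff_natDegree, hp.leadingCoeff, one_mul]
      have : ((p.natDegree - 1 : ℕ) : F) + 1 = ((p.natDegree - 1 + 1 : ℕ) : F) := by push_cast; rfl
      rw [this, Nat.sub_add_cancel hp0]
    have hder1 : w (p.derivative.coeff (p.natDegree - 1)) = 1 := by
      rw [hder, hchar _ (by omega)]
    have hder0 : p.derivative ≠ 0 := by
      intro h0
      rw [h0, coeff_zero, map_zero] at hder1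
      exact zero_ne_one hder1
    obtain ⟨d, hd, s, hs, hds⟩ := hfac p.derivative (natDegree_derivative_lt hp0.ne') hder0
    have hd1 : 1 ≤ w d := by
      by_contra hlt
      push Not at hlt
      have h1 := hds (p.natDegree - 1)
      rw [coeff_sub, coeff_C_mul, w.map_sub_eq_of_lt_left, hder1] at h1
      · exact h1.not_ge hlt.le
      · rw [hder1, map_mul]
        exact (mul_le_of_le_one_right' (w.map_prod_X_sub_C_coeff_le_one hs _)).trans_lt hlt
    have hpu' : v j ((p.map (i j)).derivative.eval u) = 1 := by
      refine le_antisymm ?_ ?_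
      · have h1 := (v j).map_eval_le_one ((v j).map_hasseDeriv_coeff_le_one (hcoeff j) 1) hu1
        rwa [hasseDeriv_one] at h1
      · rw [derivative_map, eval_map,
          (map_eval₂_of_approx_factorization (h.val j) hd hds hu1 fun c hc ↦ huc c (hs c hc)).1]
        exact hd1
    obtain ⟨y, hyu, hy⟩ := (hv j).hensel.exists_root_near (hcoeff j) hu1 hpu hpu'
    exact ⟨y, (hB j).mem_of_sub_mem hyu hu, by rwa [eval_map] at hy, fun c hc ↦
      Valuation.map_sub_eq_one_of_near hyu (huc c hc)⟩
  choose y hyB hy0 hyc using hroot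
  obtain ⟨a, ha⟩ := h.exists_eq_of_root y hp hp0 hy0
    (fun Q hQ hQ0 ↦ by
      obtain ⟨d, hd, s, hs, hds⟩ := hfac Q hQ hQ0
      exact ⟨w d, fun j ↦ (map_eval₂_of_approx_factorization (h.val j) hd hds
        ((hB j).le_one _ (hyB j)) fun c hc ↦ hyc j c (hs c hc)).1⟩)
    (fun Q Q' hQ hQ' hQ0 hQ0' j he ↦ by
      obtain ⟨d, hd, s, hs, hds⟩ := hfac Q hQ hQ0
      obtain ⟨d', hd', s', hs', hds'⟩ := hfac Q' hQ' hQ0'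
      exact h.unit_ratio hB hd hd' hs hs' hds hds' (hyB j) (hyc j) he)
  have ha1 : w a ≤ 1 := by
    rw [← h.val j₀, ha]
    exact (hB j₀).le_one _ (hyB j₀)
  have := hyc j₀ a ha1
  rw [ha, sub_self, map_zero] at this
  exact zero_ne_one this

theorem IsMaximalExt.natCast [Nonempty J] (h : IsMaximalExt v B i w) (hv : ∀ j, (v j).IsTame)
    (n : ℕ) (hn : n ≠ 0) : w n = 1 := by
  obtain ⟨j₀⟩ := ‹Nonempty J›
  rw [← h.val j₀, map_natCast, (hv j₀).natCast n hn]

theorem IsMaximalExt.isStable [Nonempty J] (h : IsMaximalExt v B i w) (hv : ∀ j, (v j).IsTame)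
    (hB : ∀ j, (v j).IsResiduePreimage (B j)) {δ : F → Γ} (hδ : w.IsLimit δ) (Q : F[X]) :
    w.IsStable δ Q := by
  classical
  have := hδ.neBot
  by_contra hQ
  have hex : ∃ n, ∃ Q : F[X], Q.natDegree = n ∧ ¬ w.IsStable δ Q := ⟨_, Q, rfl, hQ⟩
  obtain ⟨P, hPn, hP⟩ := Nat.find_spec hex
  have hmin : ∀ R : F[X], R.natDegree < P.natDegree → w.IsStable δ R := by
    intro R hR
    by_contra hc
    exact Nat.find_min hex (hPn ▸ hR) ⟨R, rfl, hc⟩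
  have hP1 : 0 < P.natDegree := by
    by_contra h0
    refine hP ⟨w (P.coeff 0), Filter.Eventually.of_forall fun a ↦ ?_⟩
    rw [eq_C_of_natDegree_eq_zero (by omega : P.natDegree = 0)]
    simp
  have hP0 : P ≠ 0 := by rintro rfl; simp at hP1
  have hroot : ∀ j, ∃ x, P.eval₂ (i j) x = 0 ∧ ∀ a, v j (x - i j a) = δ a := fun j ↦
    hδ.exists_root (h.natCast hv) (h.val j) (hv j).hensel hmin hP
  choose x hx0 hxδ using hroot
  have hdeg : (P * C P.leadingCoeff⁻¹).natDegree = P.natDegree :=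
    natDegree_mul_C (inv_ne_zero (leadingCoeff_ne_zero.2 hP0))
  have happ : ∀ (R : F[X]), R.natDegree < P.natDegree → R ≠ 0 → ∀ j,
      ∀ᶠ a in limitFilter δ, v j (R.eval₂ (i j) (x j) - i j (R.eval a)) < w (R.eval a) ∧
        v j (R.eval₂ (i j) (x j)) = w (R.eval a) := fun R hR hR0 j ↦
    hδ.eventually_eval₂_sub_lt (h.val j) hR0
      (fun k ↦ hmin _ ((natDegree_hasseDeriv_le R k).trans_lt (by omega))) (hxδ j)
  obtain ⟨a, ha⟩ := h.exists_eq_of_root x (P := P * C P.leadingCoeff⁻¹)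
    (monic_mul_leadingCoeff_inv hP0) (by rwa [hdeg]) (fun j ↦ by simp [eval₂_mul, hx0])
    (fun R hR hR0 ↦ by
      rw [hdeg] at hR
      obtain ⟨γ, hγ⟩ := hmin R hR
      refine ⟨γ, fun j ↦ ?_⟩
      obtain ⟨a, h1, h2⟩ := (hγ.and (happ R hR hR0 j)).exists
      rw [h2.2, h1])
    (fun R R' hR hR' hR0 hR0' j he ↦ by
      rw [hdeg] at hR hR'
      obtain ⟨a, h1, h2⟩ := ((happ R hR hR0 j).and (happ R' hR' hR0' j)).exists
      refine (hB j).div_mem (h1.2 ▸ h1.1) (h2.2 ▸ h2.1) he (h.div_mem ?_ ?_ j)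
      · rw [← h1.2, ← h2.2, he]
      · rw [← w.ne_zero_iff]
        exact (lt_of_le_of_lt zero_le h2.1).ne')
  obtain ⟨j₀⟩ := ‹Nonempty J›
  have := hδ.pos a
  rw [← hxδ j₀ a, ha, sub_self, map_zero] at this
  exact lt_irrefl _ this

theorem Valuation.exists_natCast_sub_eq_one {w : Valuation F Γ}
    (hc : ∀ n : ℕ, n ≠ 0 → w (n : F) = 1) {s : Set F} (hs : s.Finite) (hs1 : ∀ c ∈ s, w c ≤ 1) :
    ∃ n : ℕ, ∀ c ∈ s, w ((n : F) - c) = 1 := by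
  have hfin : (⋃ c ∈ s, {n : ℕ | w ((n : F) - c) < 1}).Finite := by
    refine hs.biUnion fun c _ ↦ Set.Subsingleton.finite fun n hn m hm ↦ ?_
    have key : ∀ n m : ℕ, w ((n : F) - c) < 1 → w ((m : F) - c) < 1 → ¬ n < m := by
      intro n m hn hm hlt
      have e : ((m - n : ℕ) : F) = ((m : F) - c) - ((n : F) - c) := by
        rw [Nat.cast_sub hlt.le]; ring
      have h1 := hc (m - n) (by omega)
      rw [e] at h1
      exact (w.map_sub_lt hm hn).ne h1
    have h1 := key n m hn hm
    have h2 := key m n hm hn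
    omega
  obtain ⟨n, hn⟩ := hfin.infinite_compl.nonempty
  refine ⟨n, fun c hc ↦ le_antisymm (w.map_sub_le (w.map_natCast_le_one n) (hs1 c hc)) ?_⟩
  by_contra hlt
  exact hn (Set.mem_biUnion hc (not_le.1 hlt))

/-- Up to an affine change of variable, elements outside of `F` satisfy the same valuative
conditions over `F` as elements of `F`. -/
theorem IsMaximalExt.exists_approx [Nonempty J] (h : IsMaximalExt v B i w)
    (hv : ∀ j, (v j).IsTame) (hB : ∀ j, (v j).IsResiduePreimage (B j)) {j : J} {b : K j}
    (hb : b ∉ (i j).range) :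
    ∃ β, (∃ a d : F, b = i j a + i j d * β) ∧
      ∀ T : Finset F[X], ∃ x : F, ∀ Q ∈ T, w (Q.eval x) = v j (Q.eval₂ (i j) β) := by
  classical
  set δ : F → Γ := fun a ↦ v j (b - i j a) with hδ
  have hδ0 : ∀ a, δ a ≠ 0 := by
    intro a
    rw [hδ, (v j).ne_zero_iff, sub_ne_zero]
    rintro rfl
    exact hb ⟨a, rfl⟩
  by_cases hmin : ∃ a, ∀ a', δ a ≤ δ a'
  · obtain ⟨a, ha⟩ := hmin
    obtain ⟨s, hs⟩ := h.surjective hv hB (δ a)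
    have hs0 : i j s ≠ 0 := by
      rw [← (v j).ne_zero_iff, h.val, hs]
      exact hδ0 a
    set β := (b - i j a) / i j s with hβ
    have hβ1 : v j β = 1 := by
      rw [hβ, map_div₀, h.val, hs]
      exact div_self (hδ0 a)
    have hβc : ∀ c, w c ≤ 1 → v j (β - i j c) = 1 := by
      intro c hc
      refine le_antisymm ((v j).map_sub_le hβ1.le (by rwa [h.val])) ?_
      have e : β - i j c = (b - i j (a + s * c)) / i j s := by
        rw [hβ, map_add, map_mul]
        field_simp
        ring
      rw [e, map_div₀, h.val, hs, one_le_div₀ (zero_lt_iff.2 (hδ0 a))]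
      exact ha _
    refine ⟨β, ⟨a, s, by rw [hβ]; field_simp; ring⟩, fun T ↦ ?_⟩
    have hfac : ∀ Q : F[X], Q ≠ 0 → ∃ d : F, d ≠ 0 ∧ ∃ s : Multiset F, (∀ c ∈ s, w c ≤ 1) ∧
        ∀ k, w ((Q - C d * (s.map fun c ↦ X - C c).prod).coeff k) < w d := fun Q hQ0 ↦
      w.exists_approx_factorization (Q.natDegree + 1)
        (fun p h1 h2 _ h3 ↦ h.hasResidueRoots hv hB p h1 h2 h3) Q.natDegree Q hQ0 rfl
        (Nat.lt_succ_self _)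
    choose! d hd s hs hds using hfac
    obtain ⟨n, hn⟩ := Valuation.exists_natCast_sub_eq_one (h.natCast hv)
      ((T.filter (· ≠ 0)).biUnion fun Q ↦ (s Q).toFinset).finite_toSet
      (by
        intro c hc
        obtain ⟨Q, hQ, hc⟩ := Finset.mem_biUnion.1 (Finset.mem_coe.1 hc)
        exact hs Q (Finset.mem_filter.1 hQ).2 c (Multiset.mem_toFinset.1 hc))
    refine ⟨n, fun Q hQ ↦ ?_⟩
    by_cases hQ0 : Q = 0
    · simp [hQ0]
    · rw [(map_eval₂_of_approx_factorization (h.val j) (hd Q hQ0) (hds Q hQ0) hβ1.le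
        fun c hc ↦ hβc c (hs Q hQ0 c hc)).1]
      exact (map_eval₂_of_approx_factorization (i := RingHom.id F) (v := w) (fun _ ↦ rfl)
        (hd Q hQ0) (hds Q hQ0) (w.map_natCast_le_one n) fun c hc ↦
          hn c (Finset.mem_coe.2 (Finset.mem_biUnion.2
            ⟨Q, Finset.mem_filter.2 ⟨hQ, hQ0⟩, Multiset.mem_toFinset.2 hc⟩))).1
  · push Not at hmin
    have hlim : w.IsLimit δ := by
      refine ⟨hmin, fun a a' ha ↦ ?_⟩
      rw [← h.val j]
      have e : i j (a' - a) = (b - i j a) - (b - i j a') := by rw [map_sub]; ring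
      rw [e, (v j).map_sub_eq_of_lt_left ha]
    refine ⟨b, ⟨0, 1, by simp⟩, fun T ↦ ?_⟩
    have := hlim.neBot
    have hev : ∀ᶠ a in limitFilter δ, ∀ Q ∈ T, w (Q.eval a) = v j (Q.eval₂ (i j) b) := by
      refine (Filter.eventually_all_finset T).2 fun Q _ ↦ ?_
      by_cases hQ0 : Q = 0
      · exact Filter.Eventually.of_forall fun a ↦ by simp [hQ0]
      · filter_upwards [hlim.eventually_eval₂_sub_lt (h.val j) hQ0
          (fun k ↦ h.isStable hv hB hlim _) fun a ↦ rfl] with a ha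
        exact ha.2.symm
    exact hev.exists

theorem IsMaximalExt.mem_range_of_root [Nonempty J] (h : IsMaximalExt v B i w)
    (hv : ∀ j, (v j).IsTame) (hB : ∀ j, (v j).IsResiduePreimage (B j)) {j : J} {b : K j}
    {Q : F[X]} (hQ : Q ≠ 0) (hb : Q.eval₂ (i j) b = 0) : b ∈ (i j).range := by
  classical
  by_contra hbr
  obtain ⟨β, ⟨a, d, hβ⟩, hT⟩ := h.exists_approx hv hB hbr
  set P := Q.comp (C a + C d * X) with hP
  have hPβ : P.eval₂ (i j) β = 0 := by
    rw [hP, eval₂_comp, ← hb, hβ]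
    simp
  have hd : d ≠ 0 := by
    rintro rfl
    exact hbr ⟨a, by rw [hβ]; simp⟩
  have hP0 : P ≠ 0 := by
    intro h0
    refine hQ ?_
    have h1 : P.comp (C d⁻¹ * (X - C a)) = Q := by
      rw [hP, comp_assoc]
      have : (C a + C d * X).comp (C d⁻¹ * (X - C a)) = X := by
        simp only [add_comp, C_comp, mul_comp, X_comp]
        rw [← mul_assoc, ← C_mul, mul_inv_cancel₀ hd, C_1]
        ring
      rw [this, comp_X]
    rw [← h1, h0, zero_comp]
  obtain ⟨x, hx⟩ := hT (insert P (P.roots.toFinset.image fun r ↦ X - C r))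
  have h1 := hx P (Finset.mem_insert_self _ _)
  rw [hPβ, map_zero, w.zero_iff] at h1
  have h2 := hx (X - C x) (Finset.mem_insert_of_mem (Finset.mem_image_of_mem _
    (Multiset.mem_toFinset.2 ((mem_roots hP0).2 h1))))
  rw [eval_sub, eval_X, eval_C, sub_self, map_zero, eval₂_sub, eval₂_X, eval₂_C] at h2
  have h3 := sub_eq_zero.1 ((v j).zero_iff.1 h2.symm)
  exact hbr ⟨a + d * x, by rw [hβ, h3, map_add, map_mul]⟩

theorem IsMaximalExt.isTame [Nonempty J] (h : IsMaximalExt v B i w)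
    (hv : ∀ j, (v j).IsTame) (hB : ∀ j, (v j).IsResiduePreimage (B j)) : w.IsTame where
  surj := h.surjective hv hB
  natCast := h.natCast hv
  roots := h.hasResidueRoots hv hB
  hensel := by
    intro p h0 h1 h2
    obtain ⟨j⟩ := ‹Nonempty J›
    obtain ⟨y, hy, hy0⟩ := (hv j).hensel (p.map (i j)) (by rwa [coeff_map, h.val])
      (by rwa [coeff_map, h.val]) fun k hk ↦ by rw [coeff_map, h.val]; exact h2 k hk
    rw [eval_map] at hy0
    have hp : p ≠ 0 := by
      rintro rfl
      rw [coeff_zero, map_zero] at h1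
      exact zero_ne_one h1
    obtain ⟨a, rfl⟩ := h.mem_range_of_root hv hB hp hy0
    refine ⟨a, by rwa [h.val] at hy, ?_⟩
    rw [eval₂_at_apply] at hy0
    exact (map_eq_zero (i j)).1 hy0

end Maximal

/-- Satisfaction of a formula in a valued field. -/
abbrev valuedRealize {K Γ : Type*} [Field K] [LinearOrderedCommGroupWithZero Γ]
    (v : Valuation K Γ) (γ : Γ) {β : Type*} {n : ℕ} (ψ : LVR.BoundedFormula β n) (x : β → K)
    (y : Fin n → K) : Prop :=
  @FirstOrder.Language.BoundedFormula.Realize _ _ (valuedStructure v γ) _ _ ψ x y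

section Germ

open Filter

universe u w

variable {ι : Type w} (φ : Ultrafilter ι)

noncomputable instance Filter.Germ.instLinearOrderedCommGroupWithZero {Γ : Type u}
    [LinearOrderedCommGroupWithZero Γ] :
    LinearOrderedCommGroupWithZero (Germ (φ : Filter ι) Γ) :=
  { Germ.instGroupWithZero, Germ.instCommMonoid, (Germ.instLinearOrder : LinearOrder _),
    (Germ.instOrderBot : OrderBot _) with
    mul_lt_mul_of_pos_left := fun x ↦ Germ.inductionOn x fun _ hf y z ↦
      Germ.inductionOn₂ y z fun _ _ h ↦ Germ.coe_lt.2 <| (Germ.coe_lt.1 hf).mp <|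
        (Germ.coe_lt.1 h).mono fun _ ↦ mul_lt_mul_of_pos_left
    isBot_zero := fun x ↦ Germ.inductionOn x fun _ ↦
      Germ.coe_le.2 (Eventually.of_forall fun _ ↦ zero_le) }

variable {K Γ : Type u} [Field K] [LinearOrderedCommGroupWithZero Γ]

/-- The ultrapower of a valuation. -/
noncomputable def Valuation.germ (v : Valuation K Γ) :
    Valuation (Germ (φ : Filter ι) K) (Germ (φ : Filter ι) Γ) where
  toFun := Germ.map v
  map_zero' := congrArg Germ.ofFun (funext fun _ ↦ v.map_zero)
  map_one' := congrArg Germ.ofFun (funext fun _ ↦ v.map_one)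
  map_mul' x y := Germ.inductionOn₂ x y fun f g ↦
    congrArg Germ.ofFun (funext fun a ↦ v.map_mul (f a) (g a))
  map_add_le_max' x y := Germ.inductionOn₂ x y fun f g ↦ by
    rw [Germ.max_def]
    exact Germ.coe_le.2 (Eventually.of_forall fun a ↦ v.map_add (f a) (g a))

variable {φ}

theorem Valuation.germ_le_one (v : Valuation K Γ) {f : ι → K} :
    v.germ φ (f : Germ (φ : Filter ι) K) ≤ 1 ↔ ∀ᶠ a in φ, v (f a) ≤ 1 :=
  Germ.coe_le

theorem Valuation.germ_lt_one (v : Valuation K Γ) {f : ι → K} :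
    v.germ φ (f : Germ (φ : Filter ι) K) < 1 ↔ ∀ᶠ a in φ, v (f a) < 1 :=
  Germ.coe_lt

theorem Valuation.germ_eq_one (v : Valuation K Γ) {f : ι → K} :
    v.germ φ (f : Germ (φ : Filter ι) K) = 1 ↔ ∀ᶠ a in φ, v (f a) = 1 :=
  Germ.coe_eq

theorem Filter.Germ.coe_eval (q : (ι → K)[X]) (f : ι → K) :
    (q.map (Germ.coeRingHom (φ : Filter ι))).eval (f : Germ (φ : Filter ι) K) =
      ((fun a ↦ (q.map (Pi.evalRingHom (fun _ ↦ K) a)).eval (f a) : ι → K) :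
        Germ (φ : Filter ι) K) := by
  have h : (f : Germ (φ : Filter ι) K) = Germ.coeRingHom (φ : Filter ι) f := rfl
  rw [h, eval_map_apply]
  refine congrArg Germ.ofFun (funext fun a ↦ ?_)
  exact (eval_map_apply (Pi.evalRingHom (fun _ ↦ K) a) f).symm

theorem Filter.Germ.exists_map_eq (p : (Germ (φ : Filter ι) K)[X]) :
    ∃ q : (ι → K)[X], q.map (Germ.coeRingHom (φ : Filter ι)) = p ∧ q.natDegree ≤ p.natDegree := by
  obtain ⟨q, hq⟩ := Polynomial.map_surjective (Germ.coeRingHom (R := K) (φ : Filter ι))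
    (fun x ↦ Germ.inductionOn x fun f ↦ ⟨f, rfl⟩) p
  refine ⟨∑ k ∈ Finset.range (p.natDegree + 1), C (q.coeff k) * X ^ k, ?_, ?_⟩
  · conv_rhs => rw [p.as_sum_range_C_mul_X_pow, ← hq]
    simp only [Polynomial.map_sum, Polynomial.map_mul, Polynomial.map_pow, map_C, map_X, coeff_map]
    rw [hq]
  · exact natDegree_sum_le_of_forall_le _ _ fun k hk ↦
      (natDegree_C_mul_X_pow_le _ _).trans (Nat.lt_succ_iff.1 (Finset.mem_range.1 hk))

theorem Valuation.IsTame.germ {v : Valuation K Γ} (hv : v.IsTame) : (v.germ φ).IsTame where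
  surj x := Germ.inductionOn x fun f ↦ by
    choose g hg using fun a ↦ hv.surj (f a)
    exact ⟨(g : Germ (φ : Filter ι) K), congrArg Germ.ofFun (funext hg)⟩
  natCast n hn := (v.germ_eq_one (f := fun _ ↦ (n : K))).2
    (Eventually.of_forall fun _ ↦ hv.natCast n hn)
  hensel p h0 h1 h2 := by
    obtain ⟨q, rfl, hd⟩ := Germ.exists_map_eq p
    simp only [coeff_map] at h0 h1 h2
    have h0' := v.germ_le_one.1 h0
    have h1' := v.germ_eq_one.1 h1
    have h2' : ∀ᶠ a in φ, ∀ k ∈ Finset.range (q.natDegree + 1), 2 ≤ k → v (q.coeff k a) < 1 :=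
      (Finset.range _).eventually_all.2 fun k _ ↦ by
        by_cases hk : 2 ≤ k
        · filter_upwards [v.germ_lt_one.1 (h2 k hk)] with a ha _ using ha
        · exact Eventually.of_forall fun _ h ↦ (hk h).elim
    have key : ∀ a, ∃ y, (v (q.coeff 0 a) ≤ 1 → v (q.coeff 1 a) = 1 →
        (∀ k ∈ Finset.range (q.natDegree + 1), 2 ≤ k → v (q.coeff k a) < 1) →
        v y ≤ 1 ∧ (q.map (Pi.evalRingHom (fun _ ↦ K) a)).eval y = 0) := by
      intro a
      by_cases h : v (q.coeff 0 a) ≤ 1 ∧ v (q.coeff 1 a) = 1 ∧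
        (∀ k ∈ Finset.range (q.natDegree + 1), 2 ≤ k → v (q.coeff k a) < 1)
      · obtain ⟨y, hy⟩ := hv.hensel (q.map (Pi.evalRingHom (fun _ ↦ K) a))
          (by simpa using h.1) (by simpa using h.2.1) (fun k hk ↦ by
            by_cases hk' : k ∈ Finset.range (q.natDegree + 1)
            · simpa using h.2.2 k hk' hk
            · rw [coeff_map, coeff_eq_zero_of_natDegree_lt
                (by simpa [Nat.lt_succ_iff] using hk')]
              simp)
        exact ⟨y, fun _ _ _ ↦ hy⟩
      · exact ⟨0, fun a b c ↦ (h ⟨a, b, c⟩).elim⟩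
    choose y hy using key
    refine ⟨(y : Germ (φ : Filter ι) K), v.germ_le_one.2 ?_, ?_⟩
    · filter_upwards [h0', h1', h2'] with a a0 a1 a2 using (hy a a0 a1 a2).1
    · rw [Germ.coe_eval]
      refine Germ.coe_eq.2 ?_
      filter_upwards [h0', h1', h2'] with a a0 a1 a2 using (hy a a0 a1 a2).2
  roots p hm hd hc := by
    obtain ⟨q, rfl, hq⟩ := Germ.exists_map_eq p
    set n := (q.map (Germ.coeRingHom (φ : Filter ι))).natDegree with hn
    simp only [coeff_map] at hc
    have hc' : ∀ᶠ a in φ, ∀ k ∈ Finset.range (n + 1), v (q.coeff k a) ≤ 1 :=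
      (Finset.range _).eventually_all.2 fun k _ ↦ v.germ_le_one.1 (hc k)
    have hl : ∀ᶠ a in φ, q.coeff n a = 1 := by
      have : (q.map (Germ.coeRingHom (φ : Filter ι))).coeff n = 1 := hm.coeff_natDegree
      rw [coeff_map] at this
      exact Germ.coe_eq.1 this
    have key : ∀ a, ∃ y, (∀ k ∈ Finset.range (n + 1), v (q.coeff k a) ≤ 1) → q.coeff n a = 1 →
        v y ≤ 1 ∧ v ((q.map (Pi.evalRingHom (fun _ ↦ K) a)).eval y) < 1 := by
      intro a
      by_cases h : (∀ k ∈ Finset.range (n + 1), v (q.coeff k a) ≤ 1) ∧ q.coeff n a = 1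
      · have hle : (q.map (Pi.evalRingHom (fun _ ↦ K) a)).natDegree ≤ n :=
          natDegree_map_le.trans hq
        have hco : (q.map (Pi.evalRingHom (fun _ ↦ K) a)).coeff n = 1 := by simpa using h.2
        have hnd := natDegree_eq_of_le_of_coeff_ne_zero hle (hco.trans_ne one_ne_zero)
        obtain ⟨y, hy⟩ := hv.roots (q.map (Pi.evalRingHom (fun _ ↦ K) a))
          (monic_of_natDegree_le_of_coeff_eq_one n hle hco) (hnd ▸ hd) (fun k ↦ by
            by_cases hk' : k ∈ Finset.range (n + 1)
            · simpa [Valuation.mem_integer_iff] using h.1 k hk'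
            · rw [coeff_eq_zero_of_natDegree_lt (hle.trans_lt
                (by simpa [Nat.lt_succ_iff] using hk'))]
              exact Subring.zero_mem _)
        exact ⟨y, fun _ _ ↦ hy⟩
      · exact ⟨0, fun a b ↦ (h ⟨a, b⟩).elim⟩
    choose y hy using key
    refine ⟨(y : Germ (φ : Filter ι) K), v.germ_le_one.2 ?_, ?_⟩
    · filter_upwards [hc', hl] with a a0 a1 using (hy a a0 a1).1
    · rw [Germ.coe_eval]
      refine v.germ_lt_one.2 ?_
      filter_upwards [hc', hl] with a a0 a1 using (hy a a0 a1).2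

/-- **Łoś's theorem** for ultrapowers of valued fields. -/
theorem valuedStructure_germ_realize (v : Valuation K Γ) (γ : Γ) {β : Type*} {n : ℕ}
    (ψ : LVR.BoundedFormula β n) (x : β → ι → K) (y : Fin n → ι → K) :
    valuedRealize (v.germ φ) (γ : Germ (φ : Filter ι) Γ) ψ
      (fun b ↦ (x b : Germ (φ : Filter ι) K)) (fun k ↦ (y k : Germ (φ : Filter ι) K)) ↔
    ∀ᶠ a in φ, valuedRealize v γ ψ (fun b ↦ x b a) (fun k ↦ y k a) := by
  let _ : LVR.Structure K := valuedStructure v γ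
  have e : valuedStructure (v.germ φ) ((γ : Germ (φ : Filter ι) Γ)) =
      (inferInstance : LVR.Structure ((φ : Filter ι).Product fun _ ↦ K)) := by
    ext n f z
    · choose g hg using fun k ↦ Quotient.exists_rep (z k)
      obtain rfl : (fun k ↦ (g k : Germ (φ : Filter ι) K)) = z := funext hg
      refine Eq.trans ?_
        (FirstOrder.Language.Ultraproduct.funMap_cast (u := φ) (M := fun _ ↦ K) f g).symm
      cases f <;> rfl
    · choose g hg using fun k ↦ Quotient.exists_rep (z k)
      obtain rfl : (fun k ↦ (g k : Germ (φ : Filter ι) K)) = z := funext hg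
      refine Iff.trans ?_ (FirstOrder.Language.relMap_quotient_mk'
        (ps := FirstOrder.Language.Ultraproduct.setoidPrestructure (fun _ ↦ K) φ) _ f g).symm
      cases f with
      | dvd => exact Germ.coe_le
      | N => exact Germ.coe_eq
      | pow m =>
        refine ⟨?_, fun h ↦ ?_⟩
        · rintro ⟨y, hy⟩
          induction y using Germ.inductionOn with | _ y
          filter_upwards [Germ.coe_eq.1 hy] with a ha using ⟨y a, ha⟩
        · have key : ∀ a, ∃ y, (∃ z, g 0 a = z ^ (m : ℕ)) → g 0 a = y ^ (m : ℕ) := fun a ↦ by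
            by_cases ha : ∃ z, g 0 a = z ^ (m : ℕ)
            · exact ha.imp fun z hz _ ↦ hz
            · exact ⟨0, fun h ↦ (ha h).elim⟩
          choose y hy using key
          refine ⟨(y : Germ (φ : Filter ι) K), Germ.coe_eq.2 ?_⟩
          filter_upwards [h] with a ha using hy a ha
  rw [valuedRealize, e]
  exact FirstOrder.Language.Ultraproduct.boundedFormula_realize_cast (u := φ) (M := fun _ ↦ K) ψ x y

end Germ

section Elementary

open Filter FirstOrder.Language

universe u

variable {J : Type}

theorem exists_forall_term_realize_eq {Γ : Type u} [LinearOrderedCommGroupWithZero Γ] (γ : Γ)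
    {K : J → Type u} [∀ j, Field (K j)] (v : ∀ j, Valuation (K j) Γ) {R : Type u} [CommRing R]
    (i : ∀ j, R →+* K j) {β : Type*} (t : LVR.Term β) (x : β → R) :
    ∃ r : R, ∀ j, @Term.realize _ _ (valuedStructure (v j) γ) _ (fun b ↦ i j (x b)) t = i j r := by
  induction t with
  | var b => exact ⟨x b, fun j ↦ rfl⟩
  | @func n f ts ih =>
    choose r hr using ih
    cases f with
    | zero => exact ⟨0, fun j ↦ (map_zero _).symm⟩
    | one => exact ⟨1, fun j ↦ (map_one _).symm⟩
    | add =>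
      refine ⟨r 0 + r 1, fun j ↦ ?_⟩
      rw [map_add, ← hr, ← hr]
      rfl
    | mul =>
      refine ⟨r 0 * r 1, fun j ↦ ?_⟩
      rw [map_mul, ← hr, ← hr]
      rfl

theorem Valuation.IsTame.exists_pow_iff {K Γ : Type*} [Field K] [LinearOrderedCommGroupWithZero Γ]
    {v : Valuation K Γ} (hv : v.IsTame) {m : ℕ} (hm : m ≠ 0) {c : K} :
    (∃ y, c = y ^ m) ↔ ∃ δ, v c = δ ^ m := by
  constructor
  · rintro ⟨y, rfl⟩
    exact ⟨v y, map_pow _ _ _⟩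
  · rintro ⟨δ, hδ⟩
    by_cases h : δ = 0
    · rw [h, zero_pow hm, v.zero_iff] at hδ
      exact ⟨0, by rw [hδ, zero_pow hm]⟩
    · obtain ⟨b, -, hb⟩ := hv.exists_pow_eq hm h hδ
      exact ⟨b, hb.symm⟩

/-- Tame valued fields with the same value group satisfy the same formulas with parameters in a
common subring. -/
theorem valuedRealize_of_valuedRealize {β : Type*} {n : ℕ} (ψ : LVR.BoundedFormula β n) :
    ∀ {Γ : Type u} [LinearOrderedCommGroupWithZero Γ] (γ : Γ) {K : J → Type u}
      [∀ j, Field (K j)] {v : ∀ j, Valuation (K j) Γ} (_ : ∀ j, (v j).IsTame) {R : Type u}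
      [CommRing R] (i : ∀ j, R →+* K j) (_ : ∀ r j j', v j (i j r) = v j' (i j' r))
      (x : β → R) (y : Fin n → R) (j j' : J),
      valuedRealize (v j) γ ψ (fun b ↦ i j (x b)) (fun k ↦ i j (y k)) →
      valuedRealize (v j') γ ψ (fun b ↦ i j' (x b)) (fun k ↦ i j' (y k)) := by
  induction ψ with
  | falsum =>
    intro Γ _ γ K _ v _ R _ i _ x y j j' h
    exact h
  | equal t₁ t₂ =>
    intro Γ _ γ K _ v hv R _ i h x y j j' hj
    have e : ∀ j, Sum.elim (fun b ↦ i j (x b)) (fun k ↦ i j (y k)) = fun s ↦ i j (Sum.elim x y s) :=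
      fun j ↦ funext fun s ↦ by cases s <;> rfl
    obtain ⟨r₁, h₁⟩ := exists_forall_term_realize_eq γ v i t₁ (Sum.elim x y)
    obtain ⟨r₂, h₂⟩ := exists_forall_term_realize_eq γ v i t₂ (Sum.elim x y)
    simp only [valuedRealize, BoundedFormula.Realize, e, h₁, h₂] at hj ⊢
    rw [← sub_eq_zero, ← map_sub, ← (v j').zero_iff, h _ j' j, (v j).zero_iff, map_sub, hj,
      sub_self]
  | rel f ts =>
    intro Γ _ γ K _ v hv R _ i h x y j j' hj
    have e : ∀ j, Sum.elim (fun b ↦ i j (x b)) (fun k ↦ i j (y k)) = fun s ↦ i j (Sum.elim x y s) :=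
      fun j ↦ funext fun s ↦ by cases s <;> rfl
    choose r hr using fun k ↦ exists_forall_term_realize_eq γ v i (ts k) (Sum.elim x y)
    simp only [valuedRealize, BoundedFormula.Realize, e, hr] at hj ⊢
    cases f with
    | dvd =>
      change v j' (i j' _) ≤ v j' (i j' _)
      rw [h _ j' j, h _ j' j]
      exact hj
    | N =>
      change v j' (i j' _) = _
      rw [h _ j' j]
      exact hj
    | pow m =>
      refine ((hv j').exists_pow_iff m.ne_zero).2 ?_
      rw [h _ j' j]
      exact ((hv j).exists_pow_iff m.ne_zero).1 hj
  | imp ψ₁ ψ₂ ih₁ ih₂ =>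
    intro Γ _ γ K _ v hv R _ i h x y j j' hj h'
    exact ih₂ γ hv i h x y j j' (hj (ih₁ γ hv i h x y j' j h'))
  | @all n ψ ih =>
    intro Γ _ γ K _ v hv R _ i h x y j j' hj b
    have : Nonempty J := ⟨j⟩
    obtain ⟨F, _, i', w, hF, g, hg⟩ := exists_isMaximalExt (B := fun j ↦ (v j).integer) i h
      (fun r s j e h0 ↦ by
        rw [Valuation.mem_integer_iff, map_div₀, e, div_self h0])
    by_cases hb : b ∈ (i' j').range
    · obtain ⟨a, rfl⟩ := hb
      have hy : ∀ j, (fun k ↦ i' j ((Fin.snoc (fun k ↦ g (y k)) a : Fin (n + 1) → F) k)) =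
          Fin.snoc (fun k ↦ i j (y k)) (i' j a) := fun j ↦ by
        rw [← funext fun k ↦ hg j (y k)]
        exact Fin.comp_snoc (i' j) _ a
      have hx : ∀ j, (fun s ↦ i' j (g (x s))) = fun s ↦ i j (x s) := fun j ↦
        funext fun s ↦ hg j (x s)
      have := ih γ hv i' (fun r j j' ↦ by rw [hF.val, hF.val]) (fun s ↦ g (x s))
        (Fin.snoc (fun k ↦ g (y k)) a) j j'
      rw [hy, hy, hx, hx] at this
      exact this (hj _)
    · classical
      by_cases hne : j = j'
      · subst hne
        exact hj b
      obtain ⟨β', ⟨a, d, hab⟩, happ⟩ := hF.exists_approx hv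
        (fun j ↦ (hv j).isResiduePreimage) hb
      choose z hz using happ
      let φ : Ultrafilter (Finset F[X]) := Ultrafilter.of atTop
      have hφ : (φ : Filter (Finset F[X])) ≤ atTop := Ultrafilter.of_le _
      let A : F[X] →+* Germ (φ : Filter (Finset F[X])) (K j') :=
        (Germ.coeRingHom _).comp (RingHom.pi fun _ ↦ eval₂RingHom (i' j') β')
      let B : ∀ j, F[X] →+* Germ (φ : Filter (Finset F[X])) (K j) := fun j ↦
        (Germ.coeRingHom _).comp (RingHom.pi fun T ↦ (i' j).comp (evalRingHom (z T)))
      let I := Function.update B j' A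
      have hIj : I j = B j := Function.update_of_ne hne _ _
      have hIj' : I j' = A := Function.update_self _ _ _
      have hB : ∀ Q j, (v j).germ φ (B j Q) =
          ((fun _ ↦ v j' (Q.eval₂ (i' j') β') : Finset F[X] → Γ) : Germ _ Γ) := by
        intro Q j
        refine Germ.coe_eq.2 ?_
        filter_upwards [hφ (mem_atTop {Q})] with T hT
        change v j (i' j (Q.eval (z T))) = _
        rw [hF.val, hz T Q (hT (Finset.mem_singleton_self Q))]
      have hI : ∀ Q j, (v j).germ φ (I j Q) =
          ((fun _ ↦ v j' (Q.eval₂ (i' j') β') : Finset F[X] → Γ) : Germ _ Γ) := by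
        intro Q k
        by_cases hk : k = j'
        · subst hk
          rw [hIj']
          rfl
        · rw [show I k = B k from Function.update_of_ne hk _ _]
          exact hB Q k
      have key := ih (γ : Germ (φ : Filter (Finset F[X])) Γ) (fun j ↦ (hv j).germ) I
        (fun Q j j' ↦ (hI Q j).trans (hI Q j').symm) (fun s ↦ C (g (x s)))
        (Fin.snoc (fun k ↦ C (g (y k))) (C a + C d * X)) j j'
      rw [hIj, hIj'] at key
      have hxB : (fun s ↦ B j (C (g (x s)))) = fun s ↦ ((fun _ ↦ i j (x s) : Finset F[X] → K j) :
          Germ (φ : Filter (Finset F[X])) (K j)) := funext fun s ↦ congrArg Germ.ofFun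
        (funext fun T ↦ by simp [hg])
      have hxA : (fun s ↦ A (C (g (x s)))) = fun s ↦ ((fun _ ↦ i j' (x s) : Finset F[X] → K j') :
          Germ (φ : Filter (Finset F[X])) (K j')) := funext fun s ↦ congrArg Germ.ofFun
        (funext fun T ↦ by simp [hg])
      have hyB : (fun k ↦ B j ((Fin.snoc (fun k ↦ C (g (y k))) (C a + C d * X) :
          Fin (n + 1) → F[X]) k)) = fun k ↦ ((fun T ↦ (Fin.snoc (fun k ↦ i j (y k))
            (i' j (a + d * z T)) : Fin (n + 1) → K j) k : Finset F[X] → K j) :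
          Germ (φ : Filter (Finset F[X])) (K j)) := funext fun k ↦ congrArg Germ.ofFun
        (funext fun T ↦ by
          cases k using Fin.lastCases <;> simp [hg])
      have hyA : (fun k ↦ A ((Fin.snoc (fun k ↦ C (g (y k))) (C a + C d * X) :
          Fin (n + 1) → F[X]) k)) = fun k ↦ ((fun T ↦ (Fin.snoc (fun k ↦ i j' (y k))
            b : Fin (n + 1) → K j') k : Finset F[X] → K j') :
          Germ (φ : Filter (Finset F[X])) (K j')) := funext fun k ↦ congrArg Germ.ofFun
        (funext fun T ↦ by
          cases k using Fin.lastCases <;> simp [hg, hab])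
      rw [hxB, hyB, hxA, hyA] at key
      obtain ⟨-, hT⟩ := ((valuedStructure_germ_realize (v j') γ ψ _ _).1 (key
        ((valuedStructure_germ_realize (v j) γ ψ _ _).2
          (Eventually.of_forall fun T ↦ hj _)))).exists
      exact hT

end Elementary

section Sentences

open FirstOrder.Language

/-- The term `∑ k < n, c k * t ^ k`. -/
def LVR.polyTerm {α : Type*} (c : ℕ → LVR.Term α) (t : LVR.Term α) : ℕ → LVR.Term α × LVR.Term α
  | 0 => (Constants.term (L := LVR) LVRFunc.zero, Constants.term (L := LVR) LVRFunc.one)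
  | n + 1 => (Functions.apply₂ (L := LVR) LVRFunc.add (polyTerm c t n).1
      (Functions.apply₂ (L := LVR) LVRFunc.mul (c n) (polyTerm c t n).2),
    Functions.apply₂ (L := LVR) LVRFunc.mul (polyTerm c t n).2 t)

/-- The formula `s ∣ t`. -/
def LVR.dvdFormula {α : Type*} (s t : LVR.Term α) : LVR.Formula α :=
  Relations.formula₂ (L := LVR) LVRRel.dvd s t

/-- The term `0`. -/
def LVR.zeroTerm {α : Type*} : LVR.Term α := Constants.term (L := LVR) LVRFunc.zero

/-- The term `1`. -/
def LVR.oneTerm {α : Type*} : LVR.Term α := Constants.term (L := LVR) LVRFunc.one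

/-- The `k`-th coefficient of the universal polynomial of degree less than `n`. -/
def LVR.coeffTerm (n : ℕ) (k : ℕ) : LVR.Term ((Empty ⊕ Fin n) ⊕ Unit) :=
  if h : k < n then Term.var (Sum.inl (Sum.inr ⟨k, h⟩)) else LVR.zeroTerm

/-- The sentence expressing that the natural number `n` is a unit. -/
def LVR.natCastSentence (n : ℕ) : LVR.Sentence :=
  LVR.dvdFormula (LVR.polyTerm (fun _ ↦ LVR.oneTerm) LVR.oneTerm n).1 LVR.oneTerm

/-- The sentence expressing Hensel's lemma for polynomials of degree less than `n`. -/
noncomputable def LVR.henselSentence (n : ℕ) : LVR.Sentence :=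
  Formula.iAlls (Fin n) <| Formula.iExs Unit <|
    (LVR.dvdFormula LVR.oneTerm (LVR.coeffTerm n 0)).imp <|
    (LVR.dvdFormula LVR.oneTerm (LVR.coeffTerm n 1)).imp <|
    (LVR.dvdFormula (LVR.coeffTerm n 1) LVR.oneTerm).imp <|
    (Formula.iInf fun k : Fin n ↦
      (LVR.dvdFormula (LVR.coeffTerm n (k + 2)) LVR.oneTerm).not).imp <|
    LVR.dvdFormula LVR.oneTerm (Term.var (Sum.inr ())) ⊓
      Term.equal (LVR.polyTerm (LVR.coeffTerm n) (Term.var (Sum.inr ())) n).1 LVR.zeroTerm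

/-- The sentence expressing that monic polynomials of degree `n` have a root in the residue
field. -/
noncomputable def LVR.residueRootsSentence (n : ℕ) : LVR.Sentence :=
  Formula.iAlls (Fin n) <| Formula.iExs Unit <|
    (Formula.iInf fun k : Fin n ↦ LVR.dvdFormula LVR.oneTerm (LVR.coeffTerm n k)).imp <|
    LVR.dvdFormula LVR.oneTerm (Term.var (Sum.inr ())) ⊓
      (LVR.dvdFormula (Functions.apply₂ (L := LVR) LVRFunc.add
        (LVR.polyTerm (LVR.coeffTerm n) (Term.var (Sum.inr ())) n).1
        (LVR.polyTerm (LVR.coeffTerm n) (Term.var (Sum.inr ())) n).2) LVR.oneTerm).not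

variable {K Γ : Type*} [Field K] [LinearOrderedCommGroupWithZero Γ] (v : Valuation K Γ) (γ : Γ)

theorem LVR.realize_zeroTerm {α : Type*} (x : α → K) :
    @Term.realize _ _ (valuedStructure v γ) _ x LVR.zeroTerm = 0 :=
  rfl

theorem LVR.realize_oneTerm {α : Type*} (x : α → K) :
    @Term.realize _ _ (valuedStructure v γ) _ x LVR.oneTerm = 1 :=
  rfl

theorem LVR.realize_polyTerm {α : Type*} (c : ℕ → LVR.Term α) (t : LVR.Term α) (x : α → K)
    (n : ℕ) :
    @Term.realize _ _ (valuedStructure v γ) _ x (LVR.polyTerm c t n).1 =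
      ∑ k ∈ Finset.range n, @Term.realize _ _ (valuedStructure v γ) _ x (c k) *
        @Term.realize _ _ (valuedStructure v γ) _ x t ^ k ∧
    @Term.realize _ _ (valuedStructure v γ) _ x (LVR.polyTerm c t n).2 =
      @Term.realize _ _ (valuedStructure v γ) _ x t ^ n := by
  induction n with
  | zero => exact ⟨rfl, (pow_zero _).symm⟩
  | succ n ih =>
    rw [Finset.sum_range_succ, pow_succ, ← ih.1, ← ih.2]
    exact ⟨rfl, rfl⟩

theorem LVR.realize_add {α : Type*} (s t : LVR.Term α) (x : α → K) :
    @Term.realize _ _ (valuedStructure v γ) _ x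
        (Functions.apply₂ (L := LVR) LVRFunc.add s t) =
      @Term.realize _ _ (valuedStructure v γ) _ x s +
        @Term.realize _ _ (valuedStructure v γ) _ x t :=
  rfl

theorem LVR.realize_dvdFormula {α : Type*} (s t : LVR.Term α) (x : α → K) :
    @Formula.Realize _ _ (valuedStructure v γ) _ (LVR.dvdFormula s t) x ↔
      v (@Term.realize _ _ (valuedStructure v γ) _ x t) ≤
        v (@Term.realize _ _ (valuedStructure v γ) _ x s) := by
  let _ := valuedStructure v γ
  exact Formula.realize_rel₂

theorem LVR.realize_coeffTerm (n k : ℕ) (c : Fin n → K) (y : Unit → K) (e : Empty → K) :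
    @Term.realize _ _ (valuedStructure v γ) _ (Sum.elim (Sum.elim e c) y) (LVR.coeffTerm n k) =
      if h : k < n then c ⟨k, h⟩ else 0 := by
  rw [LVR.coeffTerm]
  split_ifs <;> rfl

theorem LVR.realize_natCastSentence (n : ℕ) :
    @Sentence.Realize _ K (valuedStructure v γ) (LVR.natCastSentence n) ↔ 1 ≤ v (n : K) := by
  rw [Sentence.Realize, LVR.natCastSentence, LVR.realize_dvdFormula,
    (LVR.realize_polyTerm _ _ _ _ _ _).1]
  simp [LVR.realize_oneTerm]

theorem LVR.realize_henselSentence (n : ℕ) :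
    @Sentence.Realize _ K (valuedStructure v γ) (LVR.henselSentence n) ↔
      ∀ c : ℕ → K, (∀ k, n ≤ k → c k = 0) → v (c 0) ≤ 1 → v (c 1) = 1 →
        (∀ k, 2 ≤ k → v (c k) < 1) →
        ∃ y, v y ≤ 1 ∧ ∑ k ∈ Finset.range n, c k * y ^ k = 0 := by
  let _ := valuedStructure v γ
  rw [Sentence.Realize, LVR.henselSentence, Formula.realize_iAlls]
  simp only [Formula.realize_iExs, Formula.realize_imp, Formula.realize_iInf,
    Formula.realize_not, Formula.realize_inf, Formula.realize_equal, LVR.realize_dvdFormula,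
    LVR.realize_coeffTerm, LVR.realize_polyTerm, LVR.realize_oneTerm, LVR.realize_zeroTerm,
    Term.realize_var, Sum.elim_inr, map_one, not_le]
  constructor
  · intro H c hc h0 h1 h2
    have e : ∀ k, (if h : k < n then c k else 0) = c k := fun k ↦ by
      split_ifs with h
      · rfl
      · exact (hc k (not_lt.1 h)).symm
    obtain ⟨y, hy⟩ := H fun k ↦ c k
    simp only [e] at hy
    exact ⟨y (), hy h0 h1.le h1.ge fun k ↦ h2 _ (Nat.le_add_left _ _)⟩
  · intro H c
    by_contra hn
    push Not at hn
    obtain ⟨h0, h1, h1', h2, -⟩ := hn fun _ ↦ 0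
    obtain ⟨y, hy, hy'⟩ := H (fun k ↦ if h : k < n then c ⟨k, h⟩ else 0)
      (fun k hk ↦ dif_neg (not_lt.2 hk)) h0 (le_antisymm h1 h1') (fun k hk ↦ by
        obtain ⟨k, rfl⟩ := Nat.exists_eq_add_of_le' hk
        by_cases hk' : k + 2 < n
        · exact h2 ⟨k, by omega⟩
        · simp only [dif_neg hk', map_zero, zero_lt_one])
    exact (hn fun _ ↦ y).2.2.2.2 hy hy'

theorem LVR.realize_residueRootsSentence (n : ℕ) :
    @Sentence.Realize _ K (valuedStructure v γ) (LVR.residueRootsSentence n) ↔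
      ∀ c : ℕ → K, (∀ k, n ≤ k → c k = 0) → (∀ k, v (c k) ≤ 1) →
        ∃ y, v y ≤ 1 ∧ v (∑ k ∈ Finset.range n, c k * y ^ k + y ^ n) < 1 := by
  let _ := valuedStructure v γ
  rw [Sentence.Realize, LVR.residueRootsSentence, Formula.realize_iAlls]
  simp only [Formula.realize_iExs, Formula.realize_imp, Formula.realize_iInf,
    Formula.realize_not, Formula.realize_inf, LVR.realize_dvdFormula, LVR.realize_add,
    LVR.realize_coeffTerm, LVR.realize_polyTerm, LVR.realize_oneTerm,
    Term.realize_var, Sum.elim_inr, map_one, not_le]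
  constructor
  · intro H c hc h
    have e : ∀ k, (if h : k < n then c k else 0) = c k := fun k ↦ by
      split_ifs with h
      · rfl
      · exact (hc k (not_lt.1 h)).symm
    obtain ⟨y, hy⟩ := H fun k ↦ c k
    simp only [e] at hy
    exact ⟨y (), hy fun k ↦ h k⟩
  · intro H c
    by_contra hn
    push Not at hn
    obtain ⟨h, -⟩ := hn fun _ ↦ 0
    obtain ⟨y, hy, hy'⟩ := H (fun k ↦ if h : k < n then c ⟨k, h⟩ else 0)
      (fun k hk ↦ dif_neg (not_lt.2 hk)) (fun k ↦ by
        by_cases hk : k < n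
        · exact h ⟨k, hk⟩
        · simp only [dif_neg hk, map_zero, zero_le])
    exact ((hn fun _ ↦ y).2 hy).not_gt hy'

theorem Valuation.isHensel_iff :
    v.IsHensel ↔ ∀ n, @Sentence.Realize _ K (valuedStructure v γ) (LVR.henselSentence n) := by
  simp only [LVR.realize_henselSentence]
  constructor
  · intro h n c hc h0 h1 h2
    have e : ∀ k, (∑ k ∈ Finset.range n, C (c k) * X ^ k).coeff k = c k := fun k ↦ by
      simp only [finsetSum_coeff, coeff_C_mul_X_pow]
      by_cases hk : k < n
      · simp [hk]
      · simpa [hk] using (hc k (not_lt.1 hk)).symm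
    obtain ⟨y, hy, hy'⟩ := h (∑ k ∈ Finset.range n, C (c k) * X ^ k) (by rwa [e]) (by rwa [e])
      (fun k hk ↦ by rw [e]; exact h2 k hk)
    exact ⟨y, hy, by simpa [eval_finsetSum] using hy'⟩
  · intro h p h0 h1 h2
    obtain ⟨y, hy, hy'⟩ := h (p.natDegree + 1) p.coeff
      (fun k hk ↦ coeff_eq_zero_of_natDegree_lt hk) h0 h1 h2
    exact ⟨y, hy, by rw [eval_eq_sum_range, hy']⟩

theorem Valuation.hasResidueRoots_iff :
    v.HasResidueRoots v.integer ↔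
      ∀ n, n ≠ 0 → @Sentence.Realize _ K (valuedStructure v γ) (LVR.residueRootsSentence n) := by
  simp only [LVR.realize_residueRootsSentence]
  constructor
  · intro h n hn c hc h1
    have e : ∀ k, (∑ k ∈ Finset.range n, C (c k) * X ^ k).coeff k = c k := fun k ↦ by
      simp only [finsetSum_coeff, coeff_C_mul_X_pow]
      by_cases hk : k < n
      · simp [hk]
      · simpa [hk] using (hc k (not_lt.1 hk)).symm
    have hd : (∑ k ∈ Finset.range n, C (c k) * X ^ k).degree < (n : WithBot ℕ) := by
      rw [degree_lt_iff_coeff_zero]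
      exact fun k hk ↦ (e k).trans (hc k hk)
    obtain ⟨y, hy, hy'⟩ := h (X ^ n + ∑ k ∈ Finset.range n, C (c k) * X ^ k)
      (monic_X_pow_add hd) (by
        rw [natDegree_eq_of_degree_eq_some ((degree_add_eq_left_of_degree_lt
          (by rwa [degree_X_pow])).trans (degree_X_pow n))]
        exact Nat.pos_of_ne_zero hn) (fun k ↦ by
        rw [coeff_add, e, coeff_X_pow]
        refine Subring.add_mem _ ?_ (h1 k)
        split_ifs
        · exact Subring.one_mem _
        · exact Subring.zero_mem _)
    exact ⟨y, hy, by simpa [eval_finsetSum, add_comm] using hy'⟩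
  · intro h p hm hd hc
    obtain ⟨y, hy, hy'⟩ := h p.natDegree hd.ne' (fun k ↦ if k < p.natDegree then p.coeff k else 0)
      (fun k hk ↦ if_neg (not_lt.2 hk)) (fun k ↦ by
        split_ifs
        · exact hc k
        · exact (map_zero v).trans_le zero_le)
    refine ⟨y, hy, ?_⟩
    rw [eval_eq_sum_range, Finset.sum_range_succ, hm.coeff_natDegree, one_mul]
    rwa [Finset.sum_congr rfl fun k hk ↦ by rw [if_pos (Finset.mem_range.1 hk)] ] at hy'

end Sentences

section Laurent

theorem PowerSeries.exists_add_X_mul_eval_eq {R : Type*} [CommRing R] (c : PowerSeries R)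
    (Q : (PowerSeries R)[X]) : ∃ y, y = c + PowerSeries.X * Q.eval y := by
  let f : PowerSeries R → PowerSeries R := fun y ↦ c + PowerSeries.X * Q.eval y
  have hf : ∀ n y y', PowerSeries.X ^ n ∣ y - y' → PowerSeries.X ^ (n + 1) ∣ f y - f y' := by
    intro n y y' h
    have e : f y - f y' = PowerSeries.X * (Q.eval y - Q.eval y') := by ring
    rw [e, pow_succ']
    exact mul_dvd_mul_left _ (h.trans (sub_dvd_eval_sub y y' Q))
  have h1 : ∀ n, PowerSeries.X ^ n ∣ f^[n + 1] 0 - f^[n] 0 := by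
    intro n
    induction n with
    | zero => simp
    | succ n ih =>
      rw [Function.iterate_succ_apply' f (n + 1), Function.iterate_succ_apply' f n] at *
      exact hf n _ _ ih
  have h2 : ∀ n m, n ≤ m → PowerSeries.X ^ n ∣ f^[m] 0 - f^[n] 0 := by
    intro n m hm
    induction m, hm using Nat.le_induction with
    | base => simp
    | succ m hm ih =>
      rw [← sub_add_sub_cancel _ (f^[m] 0)]
      exact dvd_add ((pow_dvd_pow _ hm).trans (h1 m)) ih
  let y : PowerSeries R := PowerSeries.mk fun n ↦ PowerSeries.coeff n (f^[n + 1] 0)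
  have hy : ∀ n, PowerSeries.X ^ n ∣ y - f^[n] 0 := by
    intro n
    rw [PowerSeries.X_pow_dvd_iff]
    intro k hk
    have := PowerSeries.X_pow_dvd_iff.1 (h2 (k + 1) n hk) k (Nat.lt_succ_self k)
    rw [map_sub, sub_eq_zero] at this ⊢
    rw [this, PowerSeries.coeff_mk]
  refine ⟨y, sub_eq_zero.1 (PowerSeries.ext fun n ↦ ?_)⟩
  refine PowerSeries.X_pow_dvd_iff.1 ?_ n (Nat.lt_succ_self n)
  change _ ∣ y - f y
  rw [← sub_sub_sub_cancel_right _ _ (f^[n + 1] 0)]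
  refine dvd_sub (hy _) ?_
  rw [Function.iterate_succ_apply']
  exact hf n _ _ (hy n)

theorem PowerSeries.exists_eval_eq_zero {R : Type*} [CommRing R] {c₀ c₁ : PowerSeries R}
    (h : IsUnit c₁) (Q : (PowerSeries R)[X]) :
    ∃ y, c₀ + c₁ * y + PowerSeries.X * Q.eval y = 0 := by
  obtain ⟨u, rfl⟩ := h
  obtain ⟨y, hy⟩ := PowerSeries.exists_add_X_mul_eval_eq
    (-(((u⁻¹ : (PowerSeries R)ˣ) : PowerSeries R) * c₀))
    (Polynomial.C (-((u⁻¹ : (PowerSeries R)ˣ) : PowerSeries R)) * Q)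
  refine ⟨y, ?_⟩
  rw [eval_mul, eval_C] at hy
  have := congrArg (fun z ↦ (u : PowerSeries R) * z) hy
  simp only [mul_add, mul_neg, Units.mul_inv_cancel_left, neg_mul, mul_left_comm _ PowerSeries.X]
    at this
  rw [this]
  ring

namespace LaurentSeries

open WithZero

variable {k : Type*} [Field k]

theorem val_lt_one_iff_exists_X_mul (f : LaurentSeries k) :
    Valued.v f < (1 : WithZero (Multiplicative ℤ)) ↔
      ∃ F : PowerSeries k, ((PowerSeries.X * F : PowerSeries k) : LaurentSeries k) = f := by
  have hX : Valued.v ((PowerSeries.X : PowerSeries k) : LaurentSeries k) =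
      (exp (-1) : WithZero (Multiplicative ℤ)) := by
    simpa using valuation_X_pow k 1
  have hX0 : ((PowerSeries.X : PowerSeries k) : LaurentSeries k) ≠ 0 := by
    intro h
    rw [h, map_zero] at hX
    exact exp_ne_zero hX.symm
  constructor
  · intro h
    have hle : Valued.v (f / ((PowerSeries.X : PowerSeries k) : LaurentSeries k)) ≤
        (1 : WithZero (Multiplicative ℤ)) := by
      rw [map_div₀, hX, div_le_one₀ (zero_lt_iff.2 exp_ne_zero)]
      by_cases h0 : Valued.v f = (0 : WithZero (Multiplicative ℤ))
      · rw [h0]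
        exact zero_le
      · rw [← exp_log h0, ← exp_zero, exp_lt_exp] at h
        rw [← exp_log h0, exp_le_exp]
        omega
    obtain ⟨F, hF⟩ := (val_le_one_iff_eq_coe k _).1 hle
    exact ⟨F, by rw [map_mul, hF, mul_div_cancel₀ _ hX0]⟩
  · rintro ⟨F, rfl⟩
    rw [map_mul, map_mul, hX]
    refine (mul_le_mul_right ((val_le_one_iff_eq_coe k _).2 ⟨F, rfl⟩) _).trans_lt ?_
    rw [mul_one, ← exp_zero, exp_lt_exp]
    omega

theorem isUnit_of_val_eq_one {F : PowerSeries k}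
    (h : Valued.v (F : LaurentSeries k) = (1 : WithZero (Multiplicative ℤ))) : IsUnit F := by
  rw [PowerSeries.isUnit_iff_constantCoeff, isUnit_iff_ne_zero]
  intro h0
  obtain ⟨G, rfl⟩ := PowerSeries.X_dvd_iff.2 h0
  exact h.not_lt ((val_lt_one_iff_exists_X_mul _).2 ⟨G, rfl⟩)

theorem isHensel :
    (Valued.v : Valuation (LaurentSeries k) (WithZero (Multiplicative ℤ))).IsHensel := by
  intro p h0 h1 h2
  obtain ⟨F₀, hF₀⟩ := (val_le_one_iff_eq_coe k _).1 h0
  obtain ⟨F₁, hF₁⟩ := (val_le_one_iff_eq_coe k _).1 h1.le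
  choose F hF using fun n ↦ (val_lt_one_iff_exists_X_mul _).1 (h2 (n + 2) (Nat.le_add_left _ _))
  obtain ⟨y, hy⟩ := PowerSeries.exists_eval_eq_zero (c₀ := F₀)
    (isUnit_of_val_eq_one (hF₁ ▸ h1)) (∑ n ∈ Finset.range p.natDegree, C (F n) * X ^ (n + 2))
  refine ⟨y, (val_le_one_iff_eq_coe k _).2 ⟨y, rfl⟩, ?_⟩
  rw [eval_eq_sum_range' (show p.natDegree < p.natDegree + 2 by omega), Finset.sum_range_succ',
    Finset.sum_range_succ']
  simp only [zero_add, pow_zero, mul_one, pow_one, ← hF₀, ← hF₁, ← hF, add_assoc,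
    one_add_one_eq_two]
  have := congrArg (HahnSeries.ofPowerSeries ℤ k) hy
  simp only [eval_finsetSum, eval_mul, eval_C, eval_pow, eval_X, map_add, map_mul, map_sum,
    map_pow, map_zero, Finset.mul_sum] at this
  rw [← this]
  simp only [map_mul, mul_assoc]
  ring

theorem hasResidueRoots [IsAlgClosed k] :
    (Valued.v : Valuation (LaurentSeries k) (WithZero (Multiplicative ℤ))).HasResidueRoots
      (Valued.v : Valuation (LaurentSeries k) (WithZero (Multiplicative ℤ))).integer := by
  intro p hm hd hc
  obtain ⟨q, rfl, hq, hqm⟩ := lifts_and_natDegree_eq_and_monic (f := HahnSeries.ofPowerSeries ℤ k)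
    ((lifts_iff_coeff_lifts p).2 fun n ↦ (val_le_one_iff_eq_coe k _).1 (hc n)) hm
  obtain ⟨a, ha⟩ := IsAlgClosed.exists_root (q.map (PowerSeries.constantCoeff (R := k))) (by
    rw [degree_eq_natDegree (hqm.map _).ne_zero, hqm.natDegree_map, hq]
    exact_mod_cast hd.ne')
  refine ⟨(PowerSeries.C a : PowerSeries k), (val_le_one_iff_eq_coe k _).2 ⟨_, rfl⟩, ?_⟩
  rw [eval_map_apply, val_lt_one_iff_exists_X_mul]
  obtain ⟨G, hG⟩ := PowerSeries.X_dvd_iff.2 (show PowerSeries.constantCoeff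
      (q.eval (PowerSeries.C a)) = 0 by
    rw [← ha, ← eval_map_apply, PowerSeries.constantCoeff_C])
  exact ⟨G, by rw [hG]⟩

theorem one_le_val_natCast [CharZero k] {n : ℕ} (hn : n ≠ 0) :
    (1 : WithZero (Multiplicative ℤ)) ≤ Valued.v (n : LaurentSeries k) := by
  by_contra! h
  obtain ⟨F, hF⟩ := (val_lt_one_iff_exists_X_mul _).1 h
  rw [← map_natCast (HahnSeries.ofPowerSeries ℤ k)] at hF
  have := congrArg (PowerSeries.constantCoeff (R := k)) (HahnSeries.ofPowerSeries_injective hF)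
  rw [map_mul, PowerSeries.constantCoeff_X, zero_mul, map_natCast] at this
  exact hn (Nat.cast_eq_zero.1 this.symm)

end LaurentSeries

end Laurent

section Transfer

theorem Valuation.IsTame.of_elementarilyEquivalent {K Γ : Type*} [Field K]
    [LinearOrderedCommGroupWithZero Γ] {v : Valuation K Γ} (hv : Function.Surjective v) (γ : Γ)
    (h : @FirstOrder.Language.ElementarilyEquivalent LVR K (LaurentSeries ℂ)
      (valuedStructure v γ) laurentStructure) : v.IsTame := by
  have key : ∀ ψ : LVR.Sentence, @FirstOrder.Language.Sentence.Realize _ K (valuedStructure v γ) ψ ↔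
      @FirstOrder.Language.Sentence.Realize _ (LaurentSeries ℂ) laurentStructure ψ :=
    (@FirstOrder.Language.elementarilyEquivalent_iff _ _ _ (_) (_)).1 h
  refine ⟨hv, fun n hn ↦ le_antisymm (v.map_natCast_le_one n) ?_, ?_, ?_⟩
  · exact (LVR.realize_natCastSentence v γ n).1 ((key _).2
      ((LVR.realize_natCastSentence _ _ n).2 (LaurentSeries.one_le_val_natCast hn)))
  · exact (v.isHensel_iff γ).2 fun n ↦ (key _).2
      ((Valuation.isHensel_iff _ _).1 LaurentSeries.isHensel n)
  · exact (v.hasResidueRoots_iff γ).2 fun n hn ↦ (key _).2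
      ((Valuation.hasResidueRoots_iff _ _).1 LaurentSeries.hasResidueRoots n hn)

theorem Valuation.IsTame.of_isEquiv {K Γ Γ' : Type*} [Field K]
    [LinearOrderedCommGroupWithZero Γ] [LinearOrderedCommGroupWithZero Γ'] {v : Valuation K Γ}
    {v' : Valuation K Γ'} (hv : v.IsTame) (h : v.IsEquiv v') (hv' : Function.Surjective v') :
    v'.IsTame where
  surj := hv'
  natCast n hn := h.eq_one_iff_eq_one.1 (hv.natCast n hn)
  hensel p h0 h1 h2 := by
    obtain ⟨y, hy, hy'⟩ := hv.hensel p (h.le_one_iff_le_one.2 h0) (h.eq_one_iff_eq_one.2 h1)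
      fun k hk ↦ h.lt_one_iff_lt_one.2 (h2 k hk)
    exact ⟨y, h.le_one_iff_le_one.1 hy, hy'⟩
  roots p hm hd hc := by
    obtain ⟨y, hy, hy'⟩ := hv.roots p hm hd fun k ↦ h.le_one_iff_le_one.2 (hc k)
    exact ⟨y, h.le_one_iff_le_one.1 hy, h.lt_one_iff_lt_one.1 hy'⟩

theorem valuedStructure_eq_of_isEquiv {K Γ Γ' : Type*} [Field K]
    [LinearOrderedCommGroupWithZero Γ] [LinearOrderedCommGroupWithZero Γ'] {v : Valuation K Γ}
    {v' : Valuation K Γ'} (h : v.IsEquiv v') (t : K) :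
    valuedStructure v (v t) = valuedStructure v' (v' t) := by
  ext n f x
  · rfl
  · cases f with
    | dvd => exact h _ _
    | N => exact h.eq_iff
    | pow m => exact Iff.rfl

universe u

/-- Embeddings of tame valued fields with the same value group are elementary. -/
theorem valuedRealize_map_iff {Γ : Type u} [LinearOrderedCommGroupWithZero Γ] (γ : Γ)
    {F K : Type u} [Field F] [Field K] {w : Valuation F Γ} {v : Valuation K Γ} (hw : w.IsTame)
    (hv : v.IsTame) (i : F →+* K) (h : ∀ x, v (i x) = w x) {β : Type*} {n : ℕ}
    (ψ : LVR.BoundedFormula β n) (x : β → F) (y : Fin n → F) :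
    valuedRealize w γ ψ x y ↔ valuedRealize v γ ψ (fun b ↦ i (x b)) (fun k ↦ i (y k)) := by
  let X : Bool → Σ' (L : Type u) (_ : Field L) (_ : Valuation L Γ), F →+* L := fun
    | false => ⟨F, _, w, RingHom.id F⟩
    | true => ⟨K, _, v, i⟩
  let _ (j : Bool) : Field (X j).1 := (X j).2.1
  have hi : ∀ r j, (X j).2.2.1 ((X j).2.2.2 r) = w r := fun r j ↦ by
    cases j
    · rfl
    · exact h r
  have key := valuedRealize_of_valuedRealize ψ γ (v := fun j ↦ (X j).2.2.1)
    (fun j ↦ by cases j <;> assumption) (fun j ↦ (X j).2.2.2)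
    (fun r j j' ↦ (hi r j).trans (hi r j').symm) x y
  exact ⟨key false true, key true false⟩

end Transfer

section Residue

variable {K : Type*} [Field K] (O : ValuationSubring K)

/-- The elements of a valuation ring whose residue lies in a given subfield. -/
def ValuationSubring.residuePreimage (E : Subfield (IsLocalRing.ResidueField O)) : Subring K :=
  (E.toSubring.comap (IsLocalRing.residue O)).map O.subtype

theorem ValuationSubring.residue_eq_iff {a b : O} :
    IsLocalRing.residue O a = IsLocalRing.residue O b ↔ O.valuation ((a : K) - b) < 1 := by
  rw [← sub_eq_zero, ← map_sub, IsLocalRing.residue_eq_zero_iff, O.valuation_lt_one_iff]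
  rfl

theorem ValuationSubring.isResiduePreimage (E : Subfield (IsLocalRing.ResidueField O))
    [IsAlgClosed E] : O.valuation.IsResiduePreimage (O.residuePreimage E) where
  le_one := by
    rintro _ ⟨a, -, rfl⟩
    exact (O.valuation_le_one_iff _).2 a.2
  mem_of_lt_one x hx := by
    refine ⟨⟨x, (O.valuation_le_one_iff _).1 hx.le⟩, ?_, rfl⟩
    have : IsLocalRing.residue O ⟨x, (O.valuation_le_one_iff _).1 hx.le⟩ = 0 :=
      (IsLocalRing.residue_eq_zero_iff _).2 ((O.valuation_lt_one_iff _).2 hx)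
    change IsLocalRing.residue O _ ∈ E
    rw [this]
    exact E.zero_mem
  inv_mem := by
    rintro _ ⟨a, ha, rfl⟩ h1
    have h1' : O.valuation ((O.subtype a)⁻¹) = 1 := by rw [map_inv₀, h1, inv_one]
    refine ⟨⟨(O.subtype a)⁻¹, (O.valuation_le_one_iff _).1 h1'.le⟩, ?_, rfl⟩
    change IsLocalRing.residue O _ ∈ E
    have h0 : (a : K) ≠ 0 := O.valuation.ne_zero_iff.1 (h1.trans_ne one_ne_zero)
    rw [eq_inv_of_mul_eq_one_right (a := IsLocalRing.residue O a) (b := IsLocalRing.residue O _)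
      (by
        rw [← map_mul, ← map_one (IsLocalRing.residue O)]
        exact congrArg _ (Subtype.ext (mul_inv_cancel₀ h0)))]
    exact E.inv_mem ha
  roots p hm hd hc := by
    obtain ⟨P, rfl, hP, hPm⟩ := lifts_and_natDegree_eq_and_monic (f := O.subtype)
      ((lifts_iff_coeff_lifts p).2 fun n ↦ by
        obtain ⟨a, -, ha⟩ := hc n
        exact ⟨a, ha⟩) hm
    obtain ⟨q, hq, hqd, hqm⟩ := lifts_and_natDegree_eq_and_monic (f := E.subtype)
      ((lifts_iff_coeff_lifts (P.map (IsLocalRing.residue O))).2 fun n ↦ by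
        obtain ⟨a, ha, ha'⟩ := hc n
        rw [coeff_map] at ha' ⊢
        obtain rfl := Subtype.ext ha'
        exact ⟨⟨_, ha⟩, rfl⟩) (hPm.map _)
    rw [hPm.natDegree_map] at hqd
    obtain ⟨e, he⟩ := IsAlgClosed.exists_root q (by
      rw [degree_eq_natDegree hqm.ne_zero, hqd, hP]
      exact_mod_cast hd.ne')
    obtain ⟨a, ha⟩ := IsLocalRing.residue_surjective (e : IsLocalRing.ResidueField O)
    refine ⟨O.subtype a, ⟨a, ?_, rfl⟩, ?_⟩
    · change IsLocalRing.residue O a ∈ E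
      rw [ha]
      exact e.2
    · rw [eval_map_apply]
      refine (O.valuation_lt_one_iff _).1 ((IsLocalRing.residue_eq_zero_iff _).1 ?_)
      rw [← eval_map_apply, ← hq, ha]
      change eval (E.subtype e) _ = 0
      rw [eval_map_apply, he, map_zero]

theorem IsMaximalExt.exists_sub_lt_one {J : Type} [Unique J] {Γ F : Type*}
    [LinearOrderedCommGroupWithZero Γ] [Field F] {v : J → Valuation K Γ} {B : J → Subring K}
    {i : J → F →+* K} {w : Valuation F Γ} (h : IsMaximalExt v B i w) (hv : ∀ j, (v j).IsTame)
    (hB : ∀ j, (v j).IsResiduePreimage (B j)) (j : J) {u : K} (hu : u ∈ B j) :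
    ∃ a, v j (u - i j a) < 1 := by
  by_contra! hn
  have huc : ∀ c, w c ≤ 1 → v j (u - i j c) = 1 := fun c hc ↦
    le_antisymm ((v j).map_sub_le ((hB j).le_one _ hu) (by rwa [h.val])) (hn c)
  have hf (Q : F[X]) (hQ : Q ≠ 0) := w.exists_approx_factorization (Q.natDegree + 1)
    (fun p h1 h2 _ h3 ↦ h.hasResidueRoots hv hB p h1 h2 h3) Q.natDegree Q hQ rfl
    (Nat.lt_succ_self _)
  obtain ⟨a, ha⟩ := h.exists_eq (fun _ ↦ True) (fun _ ↦ u) (fun Q ↦ ⟨Q, trivial, fun _ ↦ rfl⟩)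
    (fun Q _ hQ ↦ ⟨v j (Q.eval₂ (i j) u), fun j' ↦ by rw [Subsingleton.elim j' j]⟩)
    (fun Q Q' _ _ hQ hQ' j' he ↦ by
      obtain rfl := Subsingleton.elim j j'
      obtain ⟨d, hd, s, hs, hds⟩ := hf Q hQ
      obtain ⟨d', hd', s', hs', hds'⟩ := hf Q' hQ'
      exact h.unit_ratio hB hd hd' hs hs' hds hds' hu huc he)
  have := hn a
  rw [ha, sub_self, map_zero] at this
  exact this.not_gt zero_lt_one

end Residue

section ElementarySubstructure

open FirstOrder.Language

/-- The formula `∃ y, x₀ + x₁ * y = x₂`. -/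
def LVR.linearFormula : LVR.Formula (Fin 3) :=
  BoundedFormula.ex <| Term.bdEqual
    (Functions.apply₂ (L := LVR) LVRFunc.add (Term.var (Sum.inl 0))
      (Functions.apply₂ (L := LVR) LVRFunc.mul (Term.var (Sum.inl 1)) (Term.var (Sum.inr 0))))
    (Term.var (Sum.inl 2))

theorem LVR.sub_div_mem_of_isElementary {K Γ : Type*} [Field K] [LinearOrderedCommGroupWithZero Γ]
    {v : Valuation K Γ} {γ : Γ} {S : @Substructure LVR K (valuedStructure v γ)}
    (hS : @Substructure.IsElementary _ _ (_) S) (x : Fin 3 → S) (h : (x 1 : K) ≠ 0) :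
    ((x 2 - x 0) / x 1 : K) ∈ S := by
  let _ : LVR.Structure K := valuedStructure v γ
  have h1 : LVR.linearFormula.Realize (fun j ↦ (x j : K)) := by
    refine BoundedFormula.realize_ex.2 ⟨(x 2 - x 0) / x 1, ?_⟩
    change (x 0 : K) + x 1 * ((x 2 - x 0) / x 1) = x 2
    field_simp
    ring
  obtain ⟨y, hy⟩ := BoundedFormula.realize_ex.1 ((hS LVR.linearFormula x).1 h1)
  have hy' : (x 0 : K) + x 1 * y = x 2 := congrArg Subtype.val hy
  rw [← hy', add_sub_cancel_left, mul_div_cancel_left₀ _ h]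
  exact y.2

theorem LVR.exists_subring_of_isElementary {K Γ : Type*} [Field K]
    [LinearOrderedCommGroupWithZero Γ]
    {v : Valuation K Γ} {γ : Γ} {S : @Substructure LVR K (valuedStructure v γ)}
    (hS : @Substructure.IsElementary _ _ (_) S) :
    ∃ R : Subring K, (∀ x, x ∈ R ↔ x ∈ S) ∧ ∀ x ∈ R, ∀ y ∈ R, y ≠ 0 → x / y ∈ R := by
  let _ : LVR.Structure K := valuedStructure v γ
  have h0 : (0 : K) ∈ S := S.fun_mem LVRFunc.zero ![] (by simp)
  have h1 : (1 : K) ∈ S := S.fun_mem LVRFunc.one ![] (by simp)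
  refine ⟨{ carrier := S
            zero_mem' := h0
            one_mem' := h1
            add_mem' := fun {a b} ha hb ↦ S.fun_mem LVRFunc.add ![a, b]
              (Fin.forall_fin_two.2 ⟨ha, hb⟩)
            mul_mem' := fun {a b} ha hb ↦ S.fun_mem LVRFunc.mul ![a, b]
              (Fin.forall_fin_two.2 ⟨ha, hb⟩)
            neg_mem' := fun {a} ha ↦ ?_ }, fun x ↦ Iff.rfl, fun x hx y hy h ↦ ?_⟩
  · simpa using LVR.sub_div_mem_of_isElementary hS ![⟨a, ha⟩, ⟨1, h1⟩, ⟨0, h0⟩] one_ne_zero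
  · change x / y ∈ S
    simpa using LVR.sub_div_mem_of_isElementary hS ![⟨0, h0⟩, ⟨y, hy⟩, ⟨x, hx⟩] h

/-- The range of a ring homomorphism, as a substructure. -/
def LVR.rangeSubstructure {F K Γ : Type*} [Field F] [Field K] [LinearOrderedCommGroupWithZero Γ]
    (v : Valuation K Γ) (γ : Γ) (i : F →+* K) : @Substructure LVR K (valuedStructure v γ) :=
  let _ : LVR.Structure K := valuedStructure v γ
  { carrier := i.range
    fun_mem := fun f x hx ↦ by
      cases f with
      | zero => exact i.range.zero_mem
      | one => exact i.range.one_mem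
      | add => exact i.range.add_mem (hx 0) (hx 1)
      | mul => exact i.range.mul_mem (hx 0) (hx 1) }

universe u

theorem LVR.isElementary_rangeSubstructure {Γ : Type u} [LinearOrderedCommGroupWithZero Γ] (γ : Γ)
    {F K : Type u} [Field F] [Field K] {w : Valuation F Γ} {v : Valuation K Γ} (hw : w.IsTame)
    (hv : v.IsTame) (i : F →+* K) (h : ∀ x, v (i x) = w x) :
    @Substructure.IsElementary _ _ (valuedStructure v γ) (LVR.rangeSubstructure v γ i) := by
  let _ : LVR.Structure K := valuedStructure v γ
  let _ : LVR.Structure F := valuedStructure w γ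
  refine Substructure.isElementary_of_exists _ fun n φ x a ha ↦ ?_
  choose z hz using fun k ↦ (x k).2
  have hsnoc (b : F) : (fun k ↦ i ((Fin.snoc z b : Fin (n + 1) → F) k)) =
      (Fin.snoc ((↑) ∘ x) (i b) : Fin (n + 1) → K) := by
    ext k
    refine Fin.lastCases ?_ (fun k ↦ ?_) k
    · simp
    · simpa using hz k
  have hex := (valuedRealize_map_iff γ hw hv i h φ.ex default z).2
    (BoundedFormula.realize_ex.2 ⟨a, by
      convert ha using 2
      exact funext hz⟩)
  obtain ⟨b, hb⟩ := BoundedFormula.realize_ex.1 hex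
  refine ⟨⟨i b, b, rfl⟩, ?_⟩
  have := (valuedRealize_map_iff γ hw hv i h φ default _).1 hb
  rw [hsnoc] at this
  convert this using 1

theorem Valuation.IsTame.exists_isElementary {K : Type u} [Field K] {O : ValuationSubring K}
    (hO : O.valuation.IsTame) (γ : O.ValueGroup)
    {S : @Substructure LVR K (valuedStructure O.valuation γ)}
    (hS : @Substructure.IsElementary _ _ (_) S) (E : Subfield (IsLocalRing.ResidueField O))
    [IsAlgClosed E] (hE : ∀ a : O, (a : K) ∈ S → IsLocalRing.residue O a ∈ E) :
    ∃ S₁ : @Substructure LVR K (valuedStructure O.valuation γ), S ≤ S₁ ∧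
      @Substructure.IsElementary _ _ (_) S₁ ∧
      {u | ∃ a : O, (a : K) ∈ S₁ ∧ IsLocalRing.residue O a = u} = (E : Set _) := by
  obtain ⟨R, hR, hdiv⟩ := LVR.exists_subring_of_isElementary hS
  have hB (_ : Unit) := O.isResiduePreimage E
  have hv (_ : Unit) := hO
  obtain ⟨F, _, i, w, hF, g, hg⟩ := exists_isMaximalExt (J := Unit) (K := fun _ ↦ K)
    (v := fun _ ↦ O.valuation) (B := fun _ ↦ O.residuePreimage E) (fun _ ↦ R.subtype)
    (fun _ _ _ ↦ rfl) (fun r s _ h h0 ↦ by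
      have h1 : O.valuation (R.subtype r / R.subtype s) = 1 := by rw [map_div₀, h, div_self h0]
      exact ⟨⟨_, (O.valuation_le_one_iff _).1 h1.le⟩, hE _ ((hR _).1 (hdiv _ r.2 _ s.2
        (O.valuation.ne_zero_iff.1 h0))), rfl⟩)
  refine ⟨LVR.rangeSubstructure O.valuation γ (i ()), fun x hx ↦ ⟨g ⟨x, (hR x).2 hx⟩, hg () _⟩,
    LVR.isElementary_rangeSubstructure γ (hF.isTame hv hB) hO (i ()) (hF.val ()), ?_⟩
  ext e
  constructor
  · rintro ⟨a, ⟨x, hx⟩, rfl⟩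
    obtain ⟨a', ha', he⟩ := hF.mem_of_le_one hB (x := x) (by
      rw [← hF.val (), hx]
      exact (O.valuation_le_one_iff _).2 a.2) ()
    obtain rfl : a' = a := Subtype.ext (he.trans hx)
    exact ha'
  · intro he
    obtain ⟨u, rfl⟩ := IsLocalRing.residue_surjective e
    obtain ⟨x, hx⟩ := hF.exists_sub_lt_one hv hB () (u := u) ⟨u, he, rfl⟩
    have hx1 : i () x ∈ O := by
      rw [← sub_sub_cancel (u : K) (i () x)]
      exact O.sub_mem u.2 ((O.valuation_le_one_iff _).1 hx.le)
    exact ⟨⟨_, hx1⟩, ⟨x, rfl⟩, (O.residue_eq_iff.2 hx).symm⟩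

end ElementarySubstructure

/-- Let `𝕂` be a valued field whose value group has a least
positive element, regarded as an `L_VR`-structure, elementarily equivalent to
`ℂ((t))`, with residue field `k_𝕂`, and let `K` be an elementary
`L_VR`-substructure of `𝕂` (given by an elementary substructure `S`), whose
residue field `k ⊆ k_𝕂` is the image of `O_𝕂 ∩ K` under the residue map.
Then for every algebraically closed subfield `E` of `k_𝕂` containing `k`
there is an elementary `L_VR`-substructure `K₁ ⊇ K` of `𝕂` whose residue
field (the image of `O_𝕂 ∩ K₁` under the residue map) equals `E`. -/
theorem stmt_14 {𝕂 : Type*} [Field 𝕂] {Γ₀ : Type*} [LinearOrderedCommGroupWithZero Γ₀]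
    (v : Valuation 𝕂 Γ₀) (hsurj : Function.Surjective v)
    (γ₁ : Γ₀) (hγ₁ : IsLeastPos γ₁) :
    letI : LVR.Structure 𝕂 := valuedStructure v γ₁
    letI : LVR.Structure (LaurentSeries ℂ) := laurentStructure
    ∀ (_ : 𝕂 ≅[LVR] LaurentSeries ℂ)
      (S : LVR.Substructure 𝕂) (_ : S.IsElementary)
      (E : Subfield (IsLocalRing.ResidueField v.valuationSubring))
      (_ : IsAlgClosed E)
      (_ : ∀ a : v.valuationSubring, (a : 𝕂) ∈ S →
        IsLocalRing.residue v.valuationSubring a ∈ E),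
      ∃ S₁ : LVR.Substructure 𝕂, S ≤ S₁ ∧ S₁.IsElementary ∧
        {u | ∃ a : v.valuationSubring, (a : 𝕂) ∈ S₁ ∧
          IsLocalRing.residue v.valuationSubring a = u} = (E : Set _) := by
  intro h S hS E hE hSE
  obtain ⟨t, rfl⟩ := hsurj γ₁
  have hequiv := v.isEquiv_valuation_valuationSubring
  have hO := (Valuation.IsTame.of_elementarilyEquivalent hsurj _ h).of_isEquiv hequiv
    v.valuationSubring.valuation_surjective
  have hst := valuedStructure_eq_of_isEquiv hequiv t
  generalize valuedStructure v (v t) = inst at h S hS hSE hst ⊢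
  subst hst
  exact hO.exists_isElementary _ hS E hSE
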